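/- arXiv:2605.05621 — 2 statements merged into one kernel-verified Lean document; each statement's English description precedes it below -/
import Mathlib

section
/- Let V ⊆ P^n be a nonempty projective variety of degree d with irreducible components V_1, …, V_t. There exists a nonzero univariate polynomial P ∈ F[z] of degree at most nd such that for every γ ∈ F with P(γ) ≠ 0 and for every i ∈ {1, …, t}, the intersection V_i ∩ V(x_0 + γx_1 + γ^2 x_2 + ⋯ + γ^n x_n) has dimension exactly dim V_i − 1 (where dim ∅ = −1). -/
open MvPolynomial Classical

variable (F : Type) [Field F] [IsAlgClosed F]

/-- The zero set in `ℙ^n` of a homogeneous polynomial in `n+1` variables. -/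
def projZeroSet (n : ℕ) (f : MvPolynomial (Fin (n + 1)) F) :
    Set (Projectivization F (Fin (n + 1) → F)) :=
  {x | MvPolynomial.eval x.rep f = 0}

/-- A projective variety in `ℙ^n`: the common zero set of a family of
homogeneous polynomials. -/
def IsProjVariety (n : ℕ) (V : Set (Projectivization F (Fin (n + 1) → F))) : Prop :=
  ∃ S : Set (MvPolynomial (Fin (n + 1)) F),
    (∀ f ∈ S, ∃ m, f.IsHomogeneous m) ∧ V = ⋂ f ∈ S, projZeroSet F n f

/-- An irreducible projective variety. -/
def IsIrredProjVariety (n : ℕ) (V : Set (Projectivization F (Fin (n + 1) → F))) : Prop :=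
  IsProjVariety F n V ∧ V.Nonempty ∧
    ∀ A B : Set (Projectivization F (Fin (n + 1) → F)),
      IsProjVariety F n A → IsProjVariety F n B → V ⊆ A ∪ B → V ⊆ A ∨ V ⊆ B

/-- `W` is an irreducible component of `V`. -/
def IsProjIrredComponent (n : ℕ) (W V : Set (Projectivization F (Fin (n + 1) → F))) : Prop :=
  IsIrredProjVariety F n W ∧ W ⊆ V ∧
    ∀ W', IsIrredProjVariety F n W' → W ⊆ W' → W' ⊆ V → W' = W

/-- Dimension of a projective variety, as the longest chain of irreducible
subvarieties; the empty set has dimension `-1`. -/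
noncomputable def projDim (n : ℕ) (V : Set (Projectivization F (Fin (n + 1) → F))) : ℤ :=
  if V.Nonempty then
    ((sSup {m : ℕ | ∃ W : Fin (m + 1) → Set (Projectivization F (Fin (n + 1) → F)),
      (∀ i, IsIrredProjVariety F n (W i) ∧ W i ⊆ V) ∧
      ∀ i j, i < j → W i ⊂ W j} : ℕ) : ℤ)
  else -1

/-- `L` is a projective linear subspace of (projective) dimension `k` in `ℙ^n`. -/
def IsProjSubspaceOfDim (n k : ℕ) (L : Set (Projectivization F (Fin (n + 1) → F))) : Prop :=
  ∃ E : Submodule F (Fin (n + 1) → F), Module.finrank F E = k + 1 ∧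
    L = {x | x.rep ∈ E}

/-- Degree of an irreducible projective variety: the largest finite number of
points in its intersection with a linear subspace of complementary dimension. -/
noncomputable def projIrredDegree (n : ℕ) (V : Set (Projectivization F (Fin (n + 1) → F))) : ℕ :=
  sSup {m : ℕ | ∃ L, IsProjSubspaceOfDim F n (n - (projDim F n V).toNat) L ∧
    (V ∩ L).Finite ∧ (V ∩ L).ncard = m}

/-- Degree of a projective variety: the sum of the degrees of its irreducible
components. -/
noncomputable def projDegree (n : ℕ) (V : Set (Projectivization F (Fin (n + 1) → F))) : ℕ :=
  ∑ᶠ W ∈ {W | IsProjIrredComponent F n W V}, projIrredDegree F n W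

/-- `W` evades `V` if for every irreducible component `Vᵢ` of `V` one has
`dim (Vᵢ ∩ W) ≤ dim Vᵢ + dim W - n`. -/
def Evades (n : ℕ) (W V : Set (Projectivization F (Fin (n + 1) → F))) : Prop :=
  ∀ Vi, IsProjIrredComponent F n Vi V →
    projDim F n (Vi ∩ W) ≤ projDim F n Vi + projDim F n W - (n : ℤ)

/-- The linear form `x₀ + α x₁ + α² x₂ + ⋯ + αⁿ xₙ`. -/
noncomputable def linForm (n : ℕ) (α : F) : MvPolynomial (Fin (n + 1)) F :=
  ∑ j : Fin (n + 1), MvPolynomial.C (α ^ (j : ℕ)) * MvPolynomial.X j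

set_option linter.unusedSectionVars false

section AuxA

variable {F} {n : ℕ}

theorem gh_hom_eval {f : MvPolynomial (Fin (n + 1)) F} {m : ℕ} (hf : f.IsHomogeneous m)
    (t : F) (v : Fin (n + 1) → F) : eval (t • v) f = t ^ m * eval v f := by
  rw [eval_eq, eval_eq, Finset.mul_sum]
  refine Finset.sum_congr rfl fun d hd => ?_
  have h1 : d.degree = m := by
    have := hf (mem_support_iff.mp hd)
    rw [Finsupp.degree_eq_weight_one]
    exact this
  have h2 : ∏ i ∈ d.support, (t • v) i ^ d i = t ^ m * ∏ i ∈ d.support, v i ^ d i := by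
    simp only [Pi.smul_apply, smul_eq_mul, mul_pow, Finset.prod_mul_distrib]
    rw [Finset.prod_pow_eq_pow_sum, ← h1]
    rfl
  rw [h2]; ring

/-- The (homogeneous) vanishing ideal of a subset of projective space. -/
noncomputable def ghI (V : Set (Projectivization F (Fin (n + 1) → F))) :
    Ideal (MvPolynomial (Fin (n + 1)) F) :=
  vanishingIdeal F {v | ∃ x ∈ V, ∃ t : F, v = t • x.rep}

theorem gh_mem_I {V : Set (Projectivization F (Fin (n + 1) → F))}
    {f : MvPolynomial (Fin (n + 1)) F} :
    f ∈ ghI V ↔ ∀ x ∈ V, ∀ t : F, eval (t • x.rep) f = 0 := by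
  unfold ghI
  rw [mem_vanishingIdeal_iff]
  constructor
  · intro h x hx t
    have := h (t • x.rep) ⟨x, hx, t, rfl⟩
    rwa [aeval_eq_eval] at this
  · rintro h v ⟨x, hx, t, rfl⟩
    rw [aeval_eq_eval]; exact h x hx t

theorem gh_mem_I_hom {V : Set (Projectivization F (Fin (n + 1) → F))}
    {f : MvPolynomial (Fin (n + 1)) F} {m : ℕ} (hf : f.IsHomogeneous m) :
    f ∈ ghI V ↔ V ⊆ projZeroSet F n f := by
  rw [gh_mem_I]
  constructor
  · intro h x hx
    have := h x hx 1
    simpa [projZeroSet] using this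
  · intro h x hx t
    rw [gh_hom_eval hf]
    have : eval x.rep f = 0 := h hx
    rw [this, mul_zero]

theorem gh_component_mem {V : Set (Projectivization F (Fin (n + 1) → F))}
    {f : MvPolynomial (Fin (n + 1)) F} (hf : f ∈ ghI V) (i : ℕ) :
    homogeneousComponent i f ∈ ghI V := by
  rw [gh_mem_I_hom (homogeneousComponent_isHomogeneous i f)]
  intro x hx
  show eval x.rep _ = 0
  rw [gh_mem_I] at hf
  let q : Polynomial F := ∑ j ∈ Finset.range (f.totalDegree + 1),
    Polynomial.C (eval x.rep (homogeneousComponent j f)) * Polynomial.X ^ j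
  have hq : q = 0 := by
    apply Polynomial.funext
    intro s
    rw [Polynomial.eval_zero, ← hf x hx s]
    conv_rhs => rw [← sum_homogeneousComponent f]
    rw [map_sum]
    simp only [q, Polynomial.eval_finsetSum]
    refine Finset.sum_congr rfl fun j _ => ?_
    rw [gh_hom_eval (homogeneousComponent_isHomogeneous j f)]
    rw [Polynomial.eval_mul, Polynomial.eval_C, Polynomial.eval_pow, Polynomial.eval_X, mul_comm]
  by_cases hi : i < f.totalDegree + 1
  · have := congrArg (fun p => Polynomial.coeff p i) hq
    simp only [q, Polynomial.finsetSum_coeff, Polynomial.coeff_C_mul_X_pow,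
      Polynomial.coeff_zero] at this
    rw [Finset.sum_ite_eq] at this
    simpa [hi] using this
  · rw [homogeneousComponent_eq_zero _ _ (by omega), map_zero]

attribute [local instance] MvPolynomial.gradedAlgebra

theorem gh_I_homogeneous (V : Set (Projectivization F (Fin (n + 1) → F))) :
    (ghI V).IsHomogeneous (homogeneousSubmodule (Fin (n + 1)) F) := by
  intro i f hf
  have := gh_component_mem hf i
  rw [← decomposition.decompose'_apply] at this
  exact this

theorem gh_mem_of_I {V : Set (Projectivization F (Fin (n + 1) → F))} (hV : IsProjVariety F n V)
    (v : Fin (n + 1) → F) (hv : v ≠ 0) (h : ∀ f ∈ ghI V, eval v f = 0) :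
    Projectivization.mk F v hv ∈ V := by
  obtain ⟨S, hS, hVS⟩ := hV
  obtain ⟨a, ha⟩ := Projectivization.exists_smul_eq_mk_rep F v hv
  rw [hVS]
  simp only [Set.mem_iInter]
  intro f hf
  obtain ⟨m, hm⟩ := hS f hf
  show eval _ f = 0
  rw [← ha]
  have : eval v f = 0 := by
    apply h
    rw [gh_mem_I_hom hm, hVS]
    exact Set.biInter_subset_of_mem hf
  have h2 := gh_hom_eval hm (a : F) v
  rw [this, mul_zero] at h2
  exact h2

theorem gh_sub_of_I {V W : Set (Projectivization F (Fin (n + 1) → F))} (hV : IsProjVariety F n V)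
    (h : ghI V ≤ ghI W) : W ⊆ V := by
  intro x hx
  have := gh_mem_of_I hV x.rep x.rep_nonzero (fun f hf => by
    simpa using gh_mem_I.mp (h hf) x hx 1)
  rwa [Projectivization.mk_rep] at this

theorem gh_I_anti {V W : Set (Projectivization F (Fin (n + 1) → F))} (h : W ⊆ V) :
    ghI V ≤ ghI W := by
  intro f hf
  rw [gh_mem_I] at *
  exact fun x hx => hf x (h hx)

theorem gh_I_lt {V W : Set (Projectivization F (Fin (n + 1) → F))} (hW : IsProjVariety F n W)
    (h : W ⊂ V) : ghI V < ghI W := by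
  refine lt_of_le_of_ne (gh_I_anti h.subset) fun he => ?_
  exact h.2 (gh_sub_of_I hW he.ge)

theorem gh_I_ne_top {V : Set (Projectivization F (Fin (n + 1) → F))} (h : V.Nonempty) :
    ghI V ≠ ⊤ := by
  obtain ⟨x, hx⟩ := h
  rw [Ideal.ne_top_iff_one]
  intro h1
  have := gh_mem_I.mp h1 x hx 1
  simp at this

theorem gh_projZeroSet_closed {f : MvPolynomial (Fin (n + 1)) F} {m : ℕ} (hf : f.IsHomogeneous m) :
    IsProjVariety F n (projZeroSet F n f) :=
  ⟨{f}, by simpa using ⟨m, hf⟩, by simp⟩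

theorem gh_I_prime {V : Set (Projectivization F (Fin (n + 1) → F))}
    (hV : IsIrredProjVariety F n V) : (ghI V).IsPrime := by
  refine (gh_I_homogeneous V).isPrime_of_homogeneous_mem_or_mem (gh_I_ne_top hV.2.1) ?_
  rintro f g ⟨i, hi⟩ ⟨j, hj⟩ hfg
  have hi' : f.IsHomogeneous i := hi
  have hj' : g.IsHomogeneous j := hj
  rw [gh_mem_I_hom hi', gh_mem_I_hom hj']
  apply hV.2.2 _ _ (gh_projZeroSet_closed hi') (gh_projZeroSet_closed hj')
  rw [gh_mem_I_hom (hi'.mul hj')] at hfg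
  intro x hx
  have : eval x.rep (f * g) = 0 := hfg hx
  rw [map_mul, mul_eq_zero] at this
  exact this

theorem gh_empty_closed : IsProjVariety F n (∅ : Set (Projectivization F (Fin (n + 1) → F))) := by
  refine ⟨{1}, by simpa using ⟨0, isHomogeneous_one _ _⟩, ?_⟩
  ext x
  simp [projZeroSet]

theorem gh_inter_closed {A B : Set (Projectivization F (Fin (n + 1) → F))}
    (hA : IsProjVariety F n A) (hB : IsProjVariety F n B) : IsProjVariety F n (A ∩ B) := by
  obtain ⟨S, hS, rfl⟩ := hA
  obtain ⟨T, hT, rfl⟩ := hB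
  refine ⟨S ∪ T, ?_, ?_⟩
  · rintro f (hf | hf)
    exacts [hS f hf, hT f hf]
  · rw [Set.biInter_union]

theorem gh_union_closed {A B : Set (Projectivization F (Fin (n + 1) → F))}
    (hA : IsProjVariety F n A) (hB : IsProjVariety F n B) : IsProjVariety F n (A ∪ B) := by
  obtain ⟨S, hS, rfl⟩ := hA
  obtain ⟨T, hT, rfl⟩ := hB
  refine ⟨{h | ∃ f ∈ S, ∃ g ∈ T, h = f * g}, ?_, ?_⟩
  · rintro h ⟨f, hf, g, hg, rfl⟩
    obtain ⟨i, hi⟩ := hS f hf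
    obtain ⟨j, hj⟩ := hT g hg
    exact ⟨_, hi.mul hj⟩
  · ext x
    simp only [Set.mem_union, Set.mem_iInter, projZeroSet, Set.mem_ofPred_eq]
    constructor
    · rintro (h | h) _ ⟨f, hf, g, hg, rfl⟩
      · rw [map_mul, h f hf, zero_mul]
      · rw [map_mul, h g hg, mul_zero]
    · intro h
      by_contra! hc
      obtain ⟨⟨f, hf, hf'⟩, ⟨g, hg, hg'⟩⟩ := hc
      have := h _ ⟨f, hf, g, hg, rfl⟩
      rw [map_mul, mul_eq_zero] at this
      exact this.elim hf' hg'

theorem gh_decomp (V : Set (Projectivization F (Fin (n + 1) → F))) (hV : IsProjVariety F n V) :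
    ∃ T : Set (Set (Projectivization F (Fin (n + 1) → F))), T.Finite ∧
      (∀ W ∈ T, IsIrredProjVariety F n W) ∧ V = ⋃₀ T := by
  have wf : WellFounded (fun I J : Ideal (MvPolynomial (Fin (n + 1)) F) => I > J) :=
    wellFounded_gt
  have key : ∀ I : Ideal (MvPolynomial (Fin (n + 1)) F), ∀ V, IsProjVariety F n V → ghI V = I →
      ∃ T : Set (Set (Projectivization F (Fin (n + 1) → F))), T.Finite ∧
      (∀ W ∈ T, IsIrredProjVariety F n W) ∧ V = ⋃₀ T := by
    intro I
    induction I using wf.induction with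
    | _ I ih =>
      intro V hV hI
      by_cases hne : V.Nonempty
      swap
      · exact ⟨∅, Set.finite_empty, by simp, by
          rw [Set.sUnion_empty]; exact Set.not_nonempty_iff_eq_empty.mp hne⟩
      by_cases hirr : IsIrredProjVariety F n V
      · exact ⟨{V}, Set.finite_singleton V, by simpa using hirr, by simp⟩
      · have : ∃ A B, IsProjVariety F n A ∧ IsProjVariety F n B ∧ V ⊆ A ∪ B ∧ ¬ V ⊆ A ∧ ¬ V ⊆ B := by
          by_contra! hc
          exact hirr ⟨hV, hne, fun A B hA hB hAB => by
            by_contra! hh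
            exact hh.2 (hc A B hA hB hAB hh.1)⟩
        obtain ⟨A, B, hA, hB, hAB, hnA, hnB⟩ := this
        have sA : V ∩ A ⊂ V := ⟨Set.inter_subset_left, fun h => hnA fun x hx => (h hx).2⟩
        have sB : V ∩ B ⊂ V := ⟨Set.inter_subset_left, fun h => hnB fun x hx => (h hx).2⟩
        have cA := gh_inter_closed hV hA
        have cB := gh_inter_closed hV hB
        obtain ⟨T1, f1, i1, e1⟩ := ih _ (hI ▸ gh_I_lt cA sA) _ cA rfl
        obtain ⟨T2, f2, i2, e2⟩ := ih _ (hI ▸ gh_I_lt cB sB) _ cB rfl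
        refine ⟨T1 ∪ T2, f1.union f2, ?_, ?_⟩
        · rintro W (h | h)
          exacts [i1 W h, i2 W h]
        · rw [Set.sUnion_union, ← e1, ← e2, ← Set.inter_union_distrib_left]
          exact (Set.inter_eq_left.mpr hAB).symm
  exact key _ V hV rfl

theorem gh_irred_sUnion {W : Set (Projectivization F (Fin (n + 1) → F))}
    (hW : IsIrredProjVariety F n W) (T : Set (Set (Projectivization F (Fin (n + 1) → F))))
    (hT : T.Finite) : (∀ A ∈ T, IsProjVariety F n A) → W ⊆ ⋃₀ T → ∃ A ∈ T, W ⊆ A := by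
  have key : (∀ A ∈ T, IsProjVariety F n A) → IsProjVariety F n (⋃₀ T) ∧
      (W ⊆ ⋃₀ T → ∃ A ∈ T, W ⊆ A) := by
    induction T, hT using Set.Finite.induction_on with
    | empty =>
      intro _
      rw [Set.sUnion_empty]
      refine ⟨gh_empty_closed, fun h => ?_⟩
      obtain ⟨x, hx⟩ := hW.2.1
      exact absurd (h hx) (Set.notMem_empty x)
    | @insert A T _ _ ih =>
      intro h
      obtain ⟨h1, h2⟩ := ih fun B hB => h B (Set.mem_insert_of_mem _ hB)
      have hA := h A (Set.mem_insert _ _)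
      rw [Set.sUnion_insert]
      refine ⟨gh_union_closed hA h1, fun hs => ?_⟩
      rcases hW.2.2 _ _ hA h1 hs with h3 | h3
      · exact ⟨A, Set.mem_insert _ _, h3⟩
      · obtain ⟨B, hB, hWB⟩ := h2 h3
        exact ⟨B, Set.mem_insert_of_mem _ hB, hWB⟩
  exact fun h => (key h).2

theorem gh_components_finite {V : Set (Projectivization F (Fin (n + 1) → F))}
    (hV : IsProjVariety F n V) : {W | IsProjIrredComponent F n W V}.Finite := by
  obtain ⟨T, hT, hTi, hTV⟩ := gh_decomp V hV
  refine hT.subset ?_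
  rintro W ⟨hW, hWV, hmax⟩
  obtain ⟨A, hA, hWA⟩ := gh_irred_sUnion hW T hT (fun A hA => (hTi A hA).1) (hTV ▸ hWV)
  have := hmax A (hTi A hA) hWA (hTV ▸ Set.subset_sUnion_of_mem hA)
  exact this ▸ hA

theorem gh_singleton_irred (x : Projectivization F (Fin (n + 1) → F)) :
    IsIrredProjVariety F n {x} := by
  refine ⟨?_, Set.singleton_nonempty x, ?_⟩
  · refine ⟨{f | ∃ i j, f = C (x.rep i) * X j - C (x.rep j) * X i}, ?_, ?_⟩
    · rintro f ⟨i, j, rfl⟩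
      refine ⟨1, ?_⟩
      have h := fun (a : F) (i : Fin (n+1)) => (isHomogeneous_C (Fin (n+1)) a).mul (isHomogeneous_X F i)
      simp only [zero_add] at h
      exact (h _ _).sub (h _ _)
    · ext y
      simp only [Set.mem_singleton_iff, Set.mem_iInter, projZeroSet, Set.mem_ofPred_eq]
      constructor
      · rintro rfl _ ⟨i, j, rfl⟩
        simp [mul_comm]
      · intro h
        obtain ⟨i, hi⟩ := Function.ne_iff.mp x.rep_nonzero
        rw [← Projectivization.mk_rep y, ← Projectivization.mk_rep x,
          Projectivization.mk_eq_mk_iff']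
        refine ⟨y.rep i / x.rep i, ?_⟩
        ext j
        have := h _ ⟨i, j, rfl⟩
        simp only [map_sub, map_mul, eval_C, eval_X] at this
        simp only [Pi.zero_apply] at hi
        simp only [Pi.smul_apply, smul_eq_mul]
        field_simp
        linear_combination -this
  · intro A B _ _ h
    simpa using h

end AuxA

section AuxB

variable {F} {n : ℕ}

/-- The linear form with coefficient vector `c`. -/
noncomputable def ghlin (c : Fin (n + 1) → F) : MvPolynomial (Fin (n + 1)) F :=
  ∑ j, C (c j) * X j

theorem gh_lin_hom (c : Fin (n + 1) → F) : (ghlin c).IsHomogeneous 1 := by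
  refine IsHomogeneous.sum _ _ _ fun j _ => ?_
  simpa using (isHomogeneous_C (Fin (n+1)) (c j)).mul (isHomogeneous_X F j)

theorem gh_lin_eval (c v : Fin (n + 1) → F) : eval v (ghlin c) = ∑ j, c j * v j := by
  simp [ghlin]

/-- The linear forms `c` have no common zero on `V`. -/
def ghNZ {k : ℕ} (c : Fin k → Fin (n + 1) → F)
    (V : Set (Projectivization F (Fin (n + 1) → F))) : Prop :=
  ∀ x ∈ V, ∃ i, eval x.rep (ghlin (c i)) ≠ 0

attribute [local instance] MvPolynomial.gradedAlgebra

theorem gh_comp_mul (N : ℕ) (h l : MvPolynomial (Fin (n + 1)) F) (hl : l.IsHomogeneous 1) :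
    homogeneousComponent (N + 1) (h * l) = homogeneousComponent N h * l := by
  have := DirectSum.coe_decompose_mul_add_of_right_mem (homogeneousSubmodule (Fin (n + 1)) F)
    (a := h) (b := l) (i := N) (j := 1) hl
  rw [← decomposition.decompose'_apply, ← decomposition.decompose'_apply]
  exact this

theorem gh_key {V : Set (Projectivization F (Fin (n + 1) → F))} (hV : IsProjVariety F n V)
    {k : ℕ} (c : Fin k → Fin (n + 1) → F) (hc : ghNZ c V) :
    ∃ N : ℕ, ∀ j, ∃ h : Fin k → MvPolynomial (Fin (n + 1)) F, (∀ i, (h i).IsHomogeneous N) ∧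
      X j ^ (N + 1) - ∑ i, h i * ghlin (c i) ∈ ghI V := by
  let J : Ideal (MvPolynomial (Fin (n + 1)) F) :=
    ghI V ⊔ Ideal.span (Set.range fun i => ghlin (c i))
  have hrad : ∀ j, X j ∈ J.radical := by
    intro j
    rw [← vanishingIdeal_zeroLocus_eq_radical (K := F) J, mem_vanishingIdeal_iff]
    intro v hv
    rw [mem_zeroLocus_iff] at hv
    by_contra hne
    have hv0 : v ≠ 0 := by
      rintro rfl
      simp at hne
    have hmem := gh_mem_of_I hV v hv0 (fun f hf => by
      have := hv f (Ideal.mem_sup_left hf)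
      rwa [aeval_eq_eval] at this)
    obtain ⟨i, hi⟩ := hc _ hmem
    obtain ⟨a, ha⟩ := Projectivization.exists_smul_eq_mk_rep F v hv0
    apply hi
    rw [← ha]
    have h2 := gh_hom_eval (gh_lin_hom (c i)) (a : F) v
    have h3 := hv (ghlin (c i)) (Ideal.mem_sup_right (Ideal.subset_span ⟨i, rfl⟩))
    rw [aeval_eq_eval] at h3
    change eval v _ = 0 at h3
    rw [h3, mul_zero] at h2
    exact h2
  choose M hM using hrad
  refine ⟨∑ j, M j, fun j => ?_⟩
  set N := ∑ j, M j
  have hle : M j ≤ N + 1 :=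
    (Finset.single_le_sum (fun i _ => Nat.zero_le _) (Finset.mem_univ j)).trans (Nat.le_succ _)
  have hmem : X j ^ (N + 1) ∈ J := J.pow_mem_of_pow_mem (hM j) hle
  obtain ⟨a, ha, b, hb, hab⟩ := Submodule.mem_sup.mp hmem
  obtain ⟨g, hg⟩ := (Ideal.mem_span_range_iff_exists_fun).mp hb
  refine ⟨fun i => homogeneousComponent N (g i), fun i => homogeneousComponent_isHomogeneous _ _, ?_⟩
  have h1 : homogeneousComponent (N + 1) (X j ^ (N + 1) : MvPolynomial (Fin (n + 1)) F)
      = X j ^ (N + 1) := by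
    apply homogeneousComponent_eq_self
    simpa using (isHomogeneous_X F j).pow (N + 1)
  have h2 : homogeneousComponent (N + 1) b = ∑ i, homogeneousComponent N (g i) * ghlin (c i) := by
    rw [← hg, map_sum]
    exact Finset.sum_congr rfl fun i _ => gh_comp_mul _ _ _ (gh_lin_hom _)
  rw [← h2, ← h1, ← hab, map_add, add_sub_cancel_right]
  exact gh_component_mem ha _

/-- Products of powers of linear forms and bounded monomials. -/
noncomputable def ghG {k : ℕ} (c : Fin k → Fin (n + 1) → F) (N t : ℕ)
    (ab : (Fin k → Fin (t + 1)) × (Fin (n + 1) → Fin (N + 1))) : MvPolynomial (Fin (n + 1)) F :=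
  (∏ i, ghlin (c i) ^ (ab.1 i : ℕ)) * ∏ j, X j ^ (ab.2 j : ℕ)

theorem gh_G_mono {k : ℕ} (c : Fin k → Fin (n + 1) → F) (N t : ℕ) :
    Submodule.span F (Set.range (ghG c N t)) ≤ Submodule.span F (Set.range (ghG c N (t + 1))) := by
  apply Submodule.span_mono
  rintro _ ⟨ab, rfl⟩
  exact ⟨(fun i => (ab.1 i).castSucc, ab.2), by simp [ghG]⟩

theorem gh_G_mul {k : ℕ} (c : Fin k → Fin (n + 1) → F) (N t : ℕ) (i : Fin k)
    {p : MvPolynomial (Fin (n + 1)) F} (hp : p ∈ Submodule.span F (Set.range (ghG c N t))) :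
    p * ghlin (c i) ∈ Submodule.span F (Set.range (ghG c N (t + 1))) := by
  induction hp using Submodule.span_induction with
  | mem x hx =>
    obtain ⟨ab, rfl⟩ := hx
    apply Submodule.subset_span
    refine ⟨(fun j => if j = i then (ab.1 j).succ else (ab.1 j).castSucc, ab.2), ?_⟩
    have : ∏ j, ghlin (c j) ^ ((if j = i then (ab.1 j).succ else (ab.1 j).castSucc : Fin (t+1+1)) : ℕ)
        = (∏ j, ghlin (c j) ^ (ab.1 j : ℕ)) * ghlin (c i) := by
      have h2 : ∀ j, ghlin (c j) ^ ((if j = i then (ab.1 j).succ else (ab.1 j).castSucc : Fin (t+1+1)) : ℕ)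
         = ghlin (c j) ^ (ab.1 j : ℕ) * (if j = i then ghlin (c i) else 1) := by
        intro j
        split_ifs with h
        · subst h; simp [pow_succ]
        · simp
      rw [Finset.prod_congr rfl fun j _ => h2 j, Finset.prod_mul_distrib, Finset.prod_ite_eq']
      simp
    simp only [ghG, this]
    ring
  | zero => simp
  | add x y _ _ hx hy => rw [add_mul]; exact add_mem hx hy
  | smul a x _ hx => rw [smul_mul_assoc]; exact Submodule.smul_mem _ _ hx

theorem gh_span {V : Set (Projectivization F (Fin (n + 1) → F))}
    {k : ℕ} (c : Fin k → Fin (n + 1) → F) (N : ℕ)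
    (hN : ∀ j, ∃ h : Fin k → MvPolynomial (Fin (n + 1)) F, (∀ i, (h i).IsHomogeneous N) ∧
      X j ^ (N + 1) - ∑ i, h i * ghlin (c i) ∈ ghI V) (t : ℕ) :
    ∀ p : MvPolynomial (Fin (n + 1)) F, p.totalDegree ≤ t →
      p ∈ Submodule.span F (Set.range (ghG c N t)) ⊔ (ghI V).restrictScalars F := by
  have small : ∀ t (d : Fin (n + 1) →₀ ℕ), (∀ j, d j ≤ N) →
      (monomial d (1 : F)) ∈ Submodule.span F (Set.range (ghG c N t)) := by
    intro t d hd
    apply Submodule.subset_span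
    refine ⟨(fun _ => 0, fun j => ⟨d j, Nat.lt_succ_of_le (hd j)⟩), ?_⟩
    rw [monomial_eq]
    simp [ghG, Finsupp.prod_fintype]
  have red : ∀ t, (∀ d : Fin (n + 1) →₀ ℕ, d.degree ≤ t →
      (monomial d (1 : F)) ∈ Submodule.span F (Set.range (ghG c N t)) ⊔ (ghI V).restrictScalars F) →
      ∀ p : MvPolynomial (Fin (n + 1)) F, p.totalDegree ≤ t →
      p ∈ Submodule.span F (Set.range (ghG c N t)) ⊔ (ghI V).restrictScalars F := by
    intro t h p hp
    rw [p.as_sum]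
    refine Submodule.sum_mem _ fun d hd => ?_
    have : monomial d (coeff d p) = coeff d p • monomial d (1 : F) := by
      rw [smul_monomial, smul_eq_mul, mul_one]
    rw [this]
    refine Submodule.smul_mem _ _ (h d ?_)
    exact (le_totalDegree hd).trans hp
  induction t with
  | zero =>
    apply red
    intro d hd
    apply Submodule.mem_sup_left
    apply small
    intro j
    exact (Finsupp.le_degree j d).trans (hd.trans (Nat.zero_le _))
  | succ t ih =>
    apply red
    intro d hd
    by_cases hs : ∀ j, d j ≤ N
    · exact Submodule.mem_sup_left (small _ d hs)
    push Not at hs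
    obtain ⟨j, hj⟩ := hs
    obtain ⟨h, hh, hmem⟩ := hN j
    obtain ⟨e, he⟩ : ∃ e : Fin (n + 1) →₀ ℕ, d = e + Finsupp.single j (N + 1) := by
      refine ⟨d - Finsupp.single j (N + 1), ?_⟩
      rw [tsub_add_cancel_of_le]
      rw [Finsupp.single_le_iff]
      exact hj
    have hmon : monomial d (1 : F) = monomial e 1 * X j ^ (N + 1) := by
      rw [X_pow_eq_monomial, monomial_mul, he, mul_one]
    have hdeg : e.degree + (N + 1) ≤ t + 1 := by
      rw [he, map_add, Finsupp.degree_single] at hd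
      exact hd
    have : monomial d (1 : F) = ∑ i, (monomial e 1 * h i) * ghlin (c i) +
        monomial e 1 * (X j ^ (N + 1) - ∑ i, h i * ghlin (c i)) := by
      rw [hmon, mul_sub, Finset.mul_sum]
      simp only [mul_assoc]
      ring
    rw [this]
    refine add_mem (Submodule.sum_mem _ fun i _ => ?_)
      (Submodule.mem_sup_right (Ideal.mul_mem_left _ _ hmem))
    have hd2 : (monomial e (1 : F) * h i).totalDegree ≤ t := by
      refine (totalDegree_mul _ _).trans ?_
      have h1 : (monomial e (1 : F)).totalDegree ≤ e.degree := by
        rw [totalDegree_monomial _ one_ne_zero]; exact le_rfl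
      have h2 := (hh i).totalDegree_le
      omega
    obtain ⟨a, ha, b, hb, hab⟩ := Submodule.mem_sup.mp (ih _ hd2)
    rw [← hab, add_mul]
    exact add_mem (Submodule.mem_sup_left (gh_G_mul c N t i ha))
      (Submodule.mem_sup_right (Ideal.mul_mem_right _ _ hb))

theorem gh_count {V : Set (Projectivization F (Fin (n + 1) → F))}
    {k : ℕ} (c : Fin k → Fin (n + 1) → F) (N : ℕ)
    (hN : ∀ j, ∃ h : Fin k → MvPolynomial (Fin (n + 1)) F, (∀ i, (h i).IsHomogeneous N) ∧
      X j ^ (N + 1) - ∑ i, h i * ghlin (c i) ∈ ghI V) (t : ℕ)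
    {ι : Type} [Fintype ι] (w : ι → MvPolynomial (Fin (n + 1)) F)
    (hw : ∀ i, (w i).totalDegree ≤ t)
    (hli : LinearIndependent F (fun i => Ideal.Quotient.mk (ghI V) (w i))) :
    Fintype.card ι ≤ (t + 1) ^ k * (N + 1) ^ (n + 1) := by
  let G := fun ab => Ideal.Quotient.mk (ghI V) (ghG c N t ab)
  have hs : Set.range (fun i => Ideal.Quotient.mk (ghI V) (w i)) ≤
      Submodule.span F (Set.range G) := by
    rintro _ ⟨i, rfl⟩
    obtain ⟨a, ha, b, hb, hab⟩ := Submodule.mem_sup.mp (gh_span c N hN t (w i) (hw i))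
    have hb' : Ideal.Quotient.mk (ghI V) b = 0 := Ideal.Quotient.eq_zero_iff_mem.mpr hb
    have h1 : Ideal.Quotient.mk (ghI V) (w i) = Ideal.Quotient.mk (ghI V) a := by
      rw [← hab, map_add, hb', add_zero]
    show Ideal.Quotient.mk (ghI V) (w i) ∈ _
    rw [h1]
    have h2 := Submodule.mem_map_of_mem (f := (Ideal.Quotient.mkₐ F (ghI V)).toLinearMap) ha
    rw [Submodule.map_span, ← Set.range_comp] at h2
    exact h2
  refine (linearIndependent_le_span_aux' _ hli (Set.range G) hs).trans ?_
  refine (Fintype.card_range_le G).trans ?_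
  simp

/-- The polynomial ring acting through linear forms. -/
noncomputable def ghA (V : Set (Projectivization F (Fin (n + 1) → F)))
    {k : ℕ} (c : Fin k → Fin (n + 1) → F) :
    MvPolynomial (Fin k) F →ₐ[F] (MvPolynomial (Fin (n + 1)) F ⧸ ghI V) :=
  aeval fun i => Ideal.Quotient.mk (ghI V) (ghlin (c i))

theorem gh_fin_abs {A B ι : Type} [CommRing A] [CommRing B] [Fintype ι] (φ : A →+* B) (b : ι → B)
    (h : ∀ x, ∃ a : ι → A, x = ∑ i, φ (a i) * b i) : φ.Finite := by
  let _ := φ.toAlgebra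
  show Module.Finite A B
  refine ⟨⟨(Set.finite_range b).toFinset, ?_⟩⟩
  rw [Set.Finite.coe_toFinset, eq_top_iff]
  rintro x -
  obtain ⟨a, rfl⟩ := h x
  refine Submodule.sum_mem _ fun i _ => ?_
  exact Submodule.smul_mem _ (a i) (Submodule.subset_span ⟨i, rfl⟩)

theorem gh_finite {V : Set (Projectivization F (Fin (n + 1) → F))} (hV : IsProjVariety F n V)
    {k : ℕ} (c : Fin k → Fin (n + 1) → F) (hc : ghNZ c V) :
    (ghA V c).toRingHom.Finite := by
  obtain ⟨N, hN⟩ := gh_key hV c hc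
  let B : (Fin (n + 1) → Fin (N + 1)) → (MvPolynomial (Fin (n + 1)) F ⧸ ghI V) :=
    fun b => Ideal.Quotient.mk (ghI V) (∏ j, X j ^ (b j : ℕ))
  refine gh_fin_abs _ B fun x => ?_
  obtain ⟨p, rfl⟩ := Ideal.Quotient.mk_surjective x
  obtain ⟨a, ha, b, hb, hab⟩ := Submodule.mem_sup.mp (gh_span c N hN _ p le_rfl)
  have hb' : Ideal.Quotient.mk (ghI V) b = 0 := Ideal.Quotient.eq_zero_iff_mem.mpr hb
  rw [← hab, map_add, hb', add_zero]
  clear hab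
  show ∃ a' : _ → MvPolynomial (Fin k) F, Ideal.Quotient.mk (ghI V) a = ∑ i, ghA V c (a' i) * B i
  induction ha using Submodule.span_induction with
  | mem x hx =>
    obtain ⟨ab, rfl⟩ := hx
    refine ⟨fun b => if b = ab.2 then ∏ i, X i ^ (ab.1 i : ℕ) else 0, ?_⟩
    rw [Finset.sum_eq_single ab.2]
    · beta_reduce
      rw [if_pos rfl, ghG, map_mul]
      congr 1
      simp [ghA]
    · intro b _ hb
      beta_reduce
      rw [if_neg hb, map_zero, zero_mul]
    · intro h
      exact absurd (Finset.mem_univ _) h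
  | zero => exact ⟨0, by simp⟩
  | add x y _ _ hx hy =>
    obtain ⟨a1, h1⟩ := hx
    obtain ⟨a2, h2⟩ := hy
    refine ⟨a1 + a2, ?_⟩
    simp only [map_add, h1, h2, Pi.add_apply, add_mul, Finset.sum_add_distrib]
  | smul r x _ hx =>
    obtain ⟨a1, h1⟩ := hx
    refine ⟨fun i => r • a1 i, ?_⟩
    have : Ideal.Quotient.mk (ghI V) (r • x) = r • Ideal.Quotient.mk (ghI V) x := rfl
    simp only [this, h1, map_smul, Finset.smul_sum, smul_mul_assoc]

theorem gh_krull_strict {A B : Type} [CommRing A] [CommRing B] (φ : A →+* B) (hφ : φ.Finite) :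
    StrictMono (PrimeSpectrum.comap φ) := by
  let _ := φ.toAlgebra
  have : Module.Finite A B := hφ
  intro p q hpq
  have : p.asIdeal < q.asIdeal := hpq
  have := Ideal.IsIntegral.comap_lt_comap (R := A) this
  exact this

theorem gh_krull_le {A B : Type} [CommRing A] [CommRing B] (φ : A →+* B) (hφ : φ.Finite) :
    ringKrullDim B ≤ ringKrullDim A :=
  Order.krullDim_le_of_strictMono _ (gh_krull_strict φ hφ)

theorem gh_krull_inj {A B : Type} [CommRing A] [IsDomain A] [CommRing B] (φ : A →+* B)
    (hφ : φ.Finite) (k : ℕ) (hA : ringKrullDim A = k) (hB : (k : WithBot ℕ∞) ≤ ringKrullDim B) :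
    Function.Injective φ := by
  rw [injective_iff_map_eq_zero]
  intro a ha
  by_contra hne
  have h1 := ringKrullDim_quotient_succ_le_of_nonZeroDivisor (mem_nonZeroDivisors_of_ne_zero hne)
  have h2 : ringKrullDim B ≤ ringKrullDim (A ⧸ Ideal.span {a}) := by
    rw [ringKrullDim_quotient]
    let f : PrimeSpectrum B → PrimeSpectrum.zeroLocus (R := A) (Ideal.span {a}) := fun p =>
      ⟨PrimeSpectrum.comap φ p, by
        rw [PrimeSpectrum.mem_zeroLocus, SetLike.coe_subset_coe, Ideal.span_singleton_le_iff_mem]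
        show φ a ∈ p.asIdeal
        rw [ha]
        exact zero_mem _⟩
    refine Order.krullDim_le_of_strictMono f ?_
    intro p q hpq
    exact gh_krull_strict φ hφ hpq
  rw [hA] at h1
  have h3 : ((k : WithBot ℕ∞)) + 1 ≤ k := le_trans (by gcongr; exact hB.trans h2) h1
  have h4 : ((k + 1 : ℕ) : WithBot ℕ∞) ≤ (k : ℕ) := by exact_mod_cast h3
  have : k + 1 ≤ k := by exact_mod_cast h4
  omega

theorem gh_krull_mv (k : ℕ) : ringKrullDim (MvPolynomial (Fin k) F) = k := by
  rw [MvPolynomial.ringKrullDim_of_isNoetherianRing, ringKrullDim_eq_zero_of_field]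
  simp

theorem gh_krull_chain {V : Set (Projectivization F (Fin (n + 1) → F))} (m : ℕ)
    (W : Fin (m + 1) → Set (Projectivization F (Fin (n + 1) → F)))
    (hW : ∀ i, IsIrredProjVariety F n (W i) ∧ W i ⊆ V) (hlt : ∀ i j, i < j → W i ⊂ W j) :
    ((m + 1 : ℕ) : WithBot ℕ∞) ≤ ringKrullDim (MvPolynomial (Fin (n + 1)) F ⧸ ghI V) := by
  rw [ringKrullDim_quotient]
  let m0 : Ideal (MvPolynomial (Fin (n + 1)) F) := RingHom.ker (eval (0 : Fin (n + 1) → F))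
  have hm0 : m0.IsPrime := RingHom.ker_isPrime _
  have hlt0 : ∀ i, ghI (W i) < m0 := by
    intro i
    obtain ⟨x, hx⟩ := (hW i).1.2.1
    refine lt_of_le_of_ne ?_ ?_
    · intro f hf
      have := gh_mem_I.mp hf x hx 0
      rw [zero_smul] at this
      exact this
    · intro he
      obtain ⟨j, hj⟩ := Function.ne_iff.mp x.rep_nonzero
      have h1 : (X j : MvPolynomial (Fin (n + 1)) F) ∈ m0 := by
        show eval _ _ = 0
        simp
      rw [← he] at h1
      have := gh_mem_I.mp h1 x hx 1
      rw [one_smul, eval_X] at this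
      exact hj this
  let f : Fin (m + 1 + 1) → PrimeSpectrum.zeroLocus (R := MvPolynomial (Fin (n + 1)) F) (ghI V) :=
    Fin.snoc (α := fun _ => PrimeSpectrum.zeroLocus (R := MvPolynomial (Fin (n + 1)) F) (ghI V))
      (fun i => ⟨⟨ghI (W i.rev), gh_I_prime (hW _).1⟩, gh_I_anti (hW _).2⟩)
      ⟨⟨m0, hm0⟩, (gh_I_anti (hW 0).2).trans (hlt0 0).le⟩
  have hf : StrictMono f := by
    rw [Fin.strictMono_iff_lt_succ]
    intro i
    induction i using Fin.lastCases with
    | last =>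
      simp only [f, Fin.succ_last, Fin.snoc_last, Fin.snoc_castSucc]
      exact hlt0 _
    | cast i =>
      rw [Fin.succ_castSucc]
      simp only [f, Fin.snoc_castSucc]
      apply gh_I_lt (hW _).1.1
      apply hlt
      rw [Fin.rev_lt_rev]
      exact Fin.castSucc_lt_succ
  exact Order.LTSeries.length_le_krullDim (LTSeries.mk (m + 1) f hf)

end AuxB

section AuxC

variable {F} {n : ℕ}

/-- Chains of length `m` in `V`. -/
def ghCh (V : Set (Projectivization F (Fin (n + 1) → F))) (m : ℕ) : Prop :=
  ∃ W : Fin (m + 1) → Set (Projectivization F (Fin (n + 1) → F)),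
      (∀ i, IsIrredProjVariety F n (W i) ∧ W i ⊆ V) ∧ ∀ i j, i < j → W i ⊂ W j

theorem gh_ch_upper {V : Set (Projectivization F (Fin (n + 1) → F))}
    {k : ℕ} (c : Fin k → Fin (n + 1) → F) (hc : ghNZ c V) (m : ℕ) (hm : ghCh V m) : m + 1 ≤ k := by
  obtain ⟨W, hW, hlt⟩ := hm
  have hL := (hW (Fin.last m))
  have h1 := gh_krull_chain (V := W (Fin.last m)) m W (fun i => ⟨(hW i).1, by
    rcases (Fin.le_last i).eq_or_lt with h | h
    · rw [h]
    · exact (hlt _ _ h).subset⟩) hlt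
  have h2 := gh_krull_le _ (gh_finite hL.1.1 c fun x hx => hc x (hL.2 hx))
  rw [gh_krull_mv] at h2
  exact_mod_cast h1.trans h2

theorem gh_irred_krull {V : Set (Projectivization F (Fin (n + 1) → F))} (m : ℕ) (hm : ghCh V m) :
    ((m + 1 : ℕ) : WithBot ℕ∞) ≤ ringKrullDim (MvPolynomial (Fin (n + 1)) F ⧸ ghI V) := by
  obtain ⟨W, hW, hlt⟩ := hm
  exact gh_krull_chain m W hW hlt

theorem gh_ch_zero {V : Set (Projectivization F (Fin (n + 1) → F))} (h : V.Nonempty) :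
    ghCh V 0 := by
  obtain ⟨x, hx⟩ := h
  refine ⟨fun _ => {x}, fun _ => ⟨gh_singleton_irred x, by simpa using hx⟩, ?_⟩
  intro i j hij
  exact absurd hij (by omega)

theorem gh_ch_nonempty {V : Set (Projectivization F (Fin (n + 1) → F))} {m : ℕ} (h : ghCh V m) :
    V.Nonempty := by
  obtain ⟨W, hW, _⟩ := h
  exact (hW 0).1.2.1.mono (hW 0).2

theorem gh_ch_ext {V V' W0 : Set (Projectivization F (Fin (n + 1) → F))} {m : ℕ}
    (hV : V' ⊆ V)
    (W : Fin (m + 1) → Set (Projectivization F (Fin (n + 1) → F)))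
    (hW : ∀ i, IsIrredProjVariety F n (W i) ∧ W i ⊆ V') (hlt : ∀ i j, i < j → W i ⊂ W j)
    (h0 : IsIrredProjVariety F n W0) (h0V : W0 ⊆ V) (h : W (Fin.last m) ⊂ W0) :
    ghCh V (m + 1) := by
  refine ⟨Fin.snoc (α := fun _ => Set (Projectivization F (Fin (n + 1) → F))) W W0, ?_, ?_⟩
  · intro i
    induction i using Fin.lastCases with
    | last => rw [Fin.snoc_last]; exact ⟨h0, h0V⟩
    | cast i => rw [Fin.snoc_castSucc]; exact ⟨(hW i).1, (hW i).2.trans hV⟩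
  · intro i j hij
    induction i using Fin.lastCases with
    | last => exact absurd hij (not_lt.mpr (Fin.le_last j))
    | cast i =>
      induction j using Fin.lastCases with
      | last =>
        rw [Fin.snoc_last, Fin.snoc_castSucc]
        rcases (Fin.le_last i).eq_or_lt with h' | h'
        · rw [h']; exact h
        · exact (hlt _ _ h').trans h
      | cast j =>
        rw [Fin.snoc_castSucc, Fin.snoc_castSucc]
        exact hlt _ _ (by simpa using hij)

theorem gh_avoid {ι : Type} [Finite ι] (v : ι → Fin (n + 1) → F) (hv : ∀ i, v i ≠ 0) :
    ∃ c : Fin (n + 1) → F, ∀ i, ∑ j, c j * v i j ≠ 0 := by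
  have := Fintype.ofFinite ι
  let q : ι → Polynomial F := fun i => ∑ j : Fin (n + 1), Polynomial.C (v i j) * Polynomial.X ^ (j : ℕ)
  have hq : ∀ i, q i ≠ 0 := by
    intro i h0
    apply hv i
    ext j
    have := congrArg (fun p => Polynomial.coeff p (j : ℕ)) h0
    simp only [q, Polynomial.finsetSum_coeff, Polynomial.coeff_C_mul_X_pow,
      Polynomial.coeff_zero] at this
    rw [Finset.sum_eq_single j] at this
    · simpa using this
    · intro b _ hb
      rw [if_neg]
      intro h
      exact hb (Fin.ext h.symm)
    · simp
  have hp : ∏ i, q i ≠ 0 := Finset.prod_ne_zero_iff.mpr fun i _ => hq i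
  obtain ⟨γ, hγ⟩ : ∃ γ, Polynomial.eval γ (∏ i, q i) ≠ 0 := by
    by_contra! hc
    exact hp (Polynomial.funext fun r => by rw [hc r, Polynomial.eval_zero])
  refine ⟨fun j => γ ^ (j : ℕ), fun i h => ?_⟩
  rw [Polynomial.eval_prod, Finset.prod_ne_zero_iff] at hγ
  apply hγ i (Finset.mem_univ i)
  simp only [q, Polynomial.eval_finsetSum, Polynomial.eval_mul, Polynomial.eval_C,
    Polynomial.eval_pow, Polynomial.eval_X]
  rw [← h]
  exact Finset.sum_congr rfl fun j _ => mul_comm _ _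

theorem gh_exists_NZ (k : ℕ) : ∀ (V : Set (Projectivization F (Fin (n + 1) → F))),
    IsProjVariety F n V → (∀ m, ghCh V m → m + 1 ≤ k) →
    ∃ c : Fin k → Fin (n + 1) → F, ghNZ c V := by
  induction k with
  | zero =>
    intro V _ h
    refine ⟨fun _ => 0, fun x hx => ?_⟩
    have := h 0 (gh_ch_zero ⟨x, hx⟩)
    omega
  | succ k ih =>
    intro V hV h
    obtain ⟨T, hT, hTi, hTV⟩ := gh_decomp V hV
    have : Finite T := hT
    choose p hp using fun W : T => (hTi W.1 W.2).2.1
    obtain ⟨c0, hc0⟩ := gh_avoid (fun W : T => (p W).rep) (fun W => (p W).rep_nonzero)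
    have hclosed := gh_inter_closed hV (gh_projZeroSet_closed (gh_lin_hom c0))
    obtain ⟨c, hc⟩ := ih (V ∩ projZeroSet F n (ghlin c0)) hclosed (by
      rintro m ⟨W, hW, hlt⟩
      have hL := hW (Fin.last m)
      obtain ⟨A, hA, hWA⟩ := gh_irred_sUnion hL.1 T hT (fun A hA => (hTi A hA).1)
        (hTV ▸ hL.2.trans Set.inter_subset_left)
      have := h (m + 1) (gh_ch_ext Set.inter_subset_left W hW hlt (hTi A hA)
        (hTV ▸ Set.subset_sUnion_of_mem hA) ⟨hWA, fun hAW => ?_⟩)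
      · omega
      · have h1 := (hL.2 (hAW (hp ⟨A, hA⟩))).2
        have h2 : eval (p ⟨A, hA⟩).rep (ghlin c0) = 0 := h1
        rw [gh_lin_eval] at h2
        exact hc0 ⟨A, hA⟩ h2)
    refine ⟨Fin.cons c0 c, fun x hx => ?_⟩
    by_cases hx0 : eval x.rep (ghlin c0) = 0
    · obtain ⟨i, hi⟩ := hc x ⟨hx, hx0⟩
      exact ⟨i.succ, by simpa using hi⟩
    · exact ⟨0, by simpa using hx0⟩

theorem gh_NZ_coord (V : Set (Projectivization F (Fin (n + 1) → F))) :
    ghNZ (fun i : Fin (n + 1) => (Pi.single i 1 : Fin (n + 1) → F)) V := by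
  intro x _
  obtain ⟨i, hi⟩ := Function.ne_iff.mp x.rep_nonzero
  refine ⟨i, ?_⟩
  rw [gh_lin_eval]
  simpa [Pi.single_apply] using hi

theorem gh_dim_spec (V : Set (Projectivization F (Fin (n + 1) → F))) (h : V.Nonempty) :
    ∃ r : ℕ, projDim F n V = r ∧ ghCh V r ∧ ∀ m, ghCh V m → m ≤ r := by
  have hb : BddAbove {m | ghCh V m} := ⟨n, fun m hm => by
    have := gh_ch_upper _ (gh_NZ_coord V) m hm
    omega⟩
  refine ⟨sSup {m | ghCh V m}, ?_, ?_, ?_⟩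
  · rw [projDim, if_pos h]
    rfl
  · exact Nat.sSup_mem ⟨0, gh_ch_zero h⟩ hb
  · exact fun m hm => le_csSup hb hm

theorem gh_dim_empty : projDim F n (∅ : Set (Projectivization F (Fin (n + 1) → F))) = -1 := by
  rw [projDim, if_neg (by simp)]

theorem gh_dim_iff {V : Set (Projectivization F (Fin (n + 1) → F))} (hV : IsProjVariety F n V)
    (k : ℕ) : (∃ c : Fin k → Fin (n + 1) → F, ghNZ c V) ↔ projDim F n V + 1 ≤ k := by
  rcases V.eq_empty_or_nonempty with rfl | hne
  · rw [gh_dim_empty]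
    refine ⟨fun _ => by omega, fun _ => ⟨0, fun x hx => absurd hx (Set.notMem_empty x)⟩⟩
  · obtain ⟨r, hr, hch, hmax⟩ := gh_dim_spec V hne
    rw [hr]
    constructor
    · rintro ⟨c, hc⟩
      have := gh_ch_upper c hc r hch
      omega
    · intro h
      refine gh_exists_NZ k V hV fun m hm => ?_
      have := hmax m hm
      omega

theorem gh_section {V : Set (Projectivization F (Fin (n + 1) → F))}
    (hV : IsIrredProjVariety F n V) (c : Fin (n + 1) → F)
    (hc : ¬ V ⊆ projZeroSet F n (ghlin c)) :
    projDim F n (V ∩ projZeroSet F n (ghlin c)) = projDim F n V - 1 := by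
  have hclosed := gh_inter_closed hV.1 (gh_projZeroSet_closed (gh_lin_hom c))
  obtain ⟨r, hr, hch, hmax⟩ := gh_dim_spec V hV.2.1
  set U := V ∩ projZeroSet F n (ghlin c) with hU
  have hlow : -1 ≤ projDim F n U := by
    rcases U.eq_empty_or_nonempty with h | h
    · rw [h, gh_dim_empty]
    · obtain ⟨s, hs, -⟩ := gh_dim_spec U h
      omega
  apply le_antisymm
  · rcases U.eq_empty_or_nonempty with h | h
    · rw [h, gh_dim_empty]; omega
    · obtain ⟨s, hs, ⟨W, hW, hlt⟩, -⟩ := gh_dim_spec U h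
      have h1 := (hW (Fin.last s)).2
      have := hmax _ (gh_ch_ext Set.inter_subset_left W hW hlt hV subset_rfl
        ⟨h1.trans Set.inter_subset_left, fun h2 => hc fun x hx => (h1 (h2 hx)).2⟩)
      omega
  · obtain ⟨k, hk⟩ := Int.eq_ofNat_of_zero_le (show 0 ≤ projDim F n U + 1 by omega)
    obtain ⟨d, hd⟩ := (gh_dim_iff hclosed k).mpr hk.le
    have : ∃ c : Fin (k + 1) → Fin (n + 1) → F, ghNZ c V := by
      refine ⟨Fin.cons c d, fun x hx => ?_⟩
      by_cases hx0 : eval x.rep (ghlin c) = 0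
      · obtain ⟨i, hi⟩ := hd x ⟨hx, hx0⟩
        exact ⟨i.succ, by simpa using hi⟩
      · exact ⟨0, by simpa using hx0⟩
    rw [gh_dim_iff hV.1] at this
    push_cast at this
    omega

theorem gh_finite_of_dim {V : Set (Projectivization F (Fin (n + 1) → F))}
    (hV : IsProjVariety F n V) (h : projDim F n V ≤ 0) : V.Finite := by
  rcases V.eq_empty_or_nonempty with rfl | hne
  · exact Set.finite_empty
  obtain ⟨r, hr, hch, hmax⟩ := gh_dim_spec V hne
  obtain ⟨T, hT, hTi, hTV⟩ := gh_decomp V hV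
  rw [hTV]
  refine hT.sUnion fun W hW => ?_
  obtain ⟨x, hx⟩ := (hTi W hW).2.1
  have hWV : W ⊆ V := hTV ▸ Set.subset_sUnion_of_mem hW
  by_contra hinf
  have : ghCh V 1 := by
    refine gh_ch_ext (V' := V) subset_rfl (fun _ : Fin (0 + 1) => {x}) (fun _ => ⟨gh_singleton_irred x,
      by simpa using hWV hx⟩) ?_ (hTi W hW) hWV ⟨by simpa using hx, fun h2 => ?_⟩
    · intro i j hij
      exact absurd hij (by omega)
    · exact hinf ((Set.finite_singleton x).subset h2)
  have := hmax _ this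
  omega

end AuxC

section AuxD

variable {F} {n : ℕ}

theorem gh_li_abs {A M : Type} [CommRing A] [IsDomain A] [IsIntegrallyClosed A] [CommRing M]
    [IsDomain M] [Algebra A M] [Module.IsTorsionFree A M] {m : ℕ} (f : M) (hf : IsIntegral A f)
    (e : Fin m → M →+* F) (ε : A →+* F) (he : ∀ i a, e i (algebraMap A M a) = ε a)
    (hd : Function.Injective fun i => e i f) : LinearIndependent A (fun j : Fin m => f ^ (j : ℕ)) := by
  have hdeg : m ≤ (minpoly A f).natDegree := by
    have hmon := minpoly.monic hf
    let q := (minpoly A f).map ε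
    have hq0 : q ≠ 0 := (hmon.map ε).ne_zero
    have hroot : ∀ i, q.IsRoot (e i f) := by
      intro i
      have h1 : e i (Polynomial.aeval f (minpoly A f)) = 0 := by rw [minpoly.aeval, map_zero]
      rw [Polynomial.aeval_def, Polynomial.hom_eval₂] at h1
      have h2 : (e i).comp (algebraMap A M) = ε := RingHom.ext (he i)
      rw [h2] at h1
      rw [Polynomial.IsRoot, Polynomial.eval_map]
      exact h1
    have h3 : (Finset.univ.image fun i => e i f).card ≤ q.natDegree := by
      have hsub : Finset.univ.image (fun i => e i f) ⊆ q.roots.toFinset := by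
        intro y hy
        obtain ⟨i, -, rfl⟩ := Finset.mem_image.mp hy
        rw [Multiset.mem_toFinset, Polynomial.mem_roots hq0]
        exact hroot i
      exact (Finset.card_le_card hsub).trans
        ((Multiset.toFinset_card_le _).trans (Polynomial.card_roots' q))
    rw [Finset.card_image_of_injective _ hd, Finset.card_univ, Fintype.card_fin] at h3
    exact h3.trans Polynomial.natDegree_map_le
  rw [Fintype.linearIndependent_iff]
  intro g hg
  let q : Polynomial A := ∑ j : Fin m, Polynomial.C (g j) * Polynomial.X ^ (j : ℕ)
  have hq : Polynomial.aeval f q = 0 := by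
    rw [← hg]
    simp only [q, map_sum, map_mul, Polynomial.aeval_C, map_pow, Polynomial.aeval_X, Algebra.smul_def]
  have hdvd := minpoly.isIntegrallyClosed_dvd hf hq
  have hq0 : q = 0 := by
    apply Polynomial.eq_zero_of_dvd_of_degree_lt hdvd
    refine (Polynomial.degree_sum_fin_lt g).trans_le ?_
    rw [Polynomial.degree_eq_natDegree (minpoly.monic hf).ne_zero]
    exact_mod_cast hdeg
  intro j
  have := congrArg (fun p => Polynomial.coeff p (j : ℕ)) hq0
  simp only [q, Polynomial.finsetSum_coeff, Polynomial.coeff_C_mul_X_pow,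
    Polynomial.coeff_zero] at this
  rw [Finset.sum_eq_single j] at this
  · simpa using this
  · intro b _ hb
    rw [if_neg]
    intro h
    exact hb (Fin.ext h.symm)
  · simp

theorem gh_li_gen {ι A M : Type} {m : ℕ} [CommRing A] [IsDomain A] [IsIntegrallyClosed A]
    [Algebra F A] [CommRing M] [IsDomain M] [Algebra F M]
    (φ : A →ₐ[F] M) (hinj : Function.Injective φ)
    (hfin : φ.toRingHom.Finite) (f : M) (e : Fin m → M →+* F)
    (ε : A →+* F) (he : ∀ i a, e i (φ a) = ε a)
    (hd : Function.Injective fun i => e i f) (b : ι → A) (hb : LinearIndependent F b) :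
    LinearIndependent F (fun p : ι × Fin m => φ (b p.1) * f ^ (p.2 : ℕ)) := by
  let _ : Algebra A M := φ.toRingHom.toAlgebra
  have : IsScalarTower F A M :=
    IsScalarTower.of_algebraMap_eq' φ.comp_algebraMap.symm
  have : Module.Finite A M := hfin
  have : Module.IsTorsionFree A M :=
    Module.isTorsionFree_iff_algebraMap_injective.mpr hinj
  have h1 := gh_li_abs (A := A) f (Algebra.IsIntegral.isIntegral f) e ε he hd
  have h2 := linearIndependent_smul hb h1
  have hfun : (fun p : ι × Fin m => b p.1 • f ^ (p.2 : ℕ)) =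
      fun p : ι × Fin m => φ (b p.1) * f ^ (p.2 : ℕ) := by
    funext p
    rw [Algebra.smul_def]
    rfl
  rw [hfun] at h2
  exact h2

theorem gh_li_mon (k s : ℕ) : LinearIndependent F (fun a : Fin k → Fin (s + 1) =>
      (∏ i, X i ^ (a i : ℕ) : MvPolynomial (Fin k) F)) := by
  let g : (Fin k → Fin (s + 1)) → (Fin k →₀ ℕ) := fun a =>
    Finsupp.equivFunOnFinite.symm fun i => (a i : ℕ)
  have hg : Function.Injective g := by
    intro a b hab
    ext i
    exact DFunLike.congr_fun hab i
  have h := (basisMonomials (Fin k) F).linearIndependent.comp g hg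
  have hfun : (fun a : Fin k → Fin (s + 1) =>
      (∏ i, X i ^ (a i : ℕ) : MvPolynomial (Fin k) F)) = ⇑(basisMonomials (Fin k) F) ∘ g := by
    funext a
    simp only [Function.comp, coe_basisMonomials]
    rw [monomial_eq]
    simp [g, Finsupp.prod_fintype]
  rw [hfun]
  exact h

theorem gh_bound {V : Set (Projectivization F (Fin (n + 1) → F))}
    (hV : IsIrredProjVariety F n V) {r : ℕ} (hr : ghCh V r)
    (c : Fin (r + 1) → Fin (n + 1) → F) (N : ℕ)
    (hN : ∀ j, ∃ h : Fin (r + 1) → MvPolynomial (Fin (n + 1)) F, (∀ i, (h i).IsHomogeneous N) ∧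
      X j ^ (N + 1) - ∑ i, h i * ghlin (c i) ∈ ghI V)
    (c' : Fin (r + 1) → Fin (n + 1) → F) (hc' : ghNZ c' V) {m : ℕ}
    (x : Fin m → Projectivization F (Fin (n + 1) → F)) (hx : ∀ i, x i ∈ V)
    (hinj : Function.Injective x) (t : Fin m → F) (ht : ∀ i, t i ≠ 0) (ε : Fin (r + 1) → F)
    (hε : ∀ i j, eval (t i • (x i).rep) (ghlin (c' j)) = ε j) :
    m ≤ (r + 1 + 1) ^ (r + 1) * (N + 1) ^ (n + 1) := by
  have hprime := gh_I_prime hV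
  have hφfin := gh_finite hV.1 c' hc'
  have hφinj : Function.Injective (ghA V c') :=
    gh_krull_inj _ hφfin (r + 1) (gh_krull_mv _) (gh_irred_krull r hr)
  have hne : ∀ i j, i ≠ j → t i • (x i).rep - t j • (x j).rep ≠ 0 := by
    intro i j hij h
    apply hij
    apply hinj
    rw [← Projectivization.mk_rep (x i), ← Projectivization.mk_rep (x j),
      Projectivization.mk_eq_mk_iff']
    refine ⟨(t i)⁻¹ * t j, ?_⟩
    rw [mul_smul, ← sub_eq_zero.mp h, smul_smul, inv_mul_cancel₀ (ht i), one_smul]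
  obtain ⟨d, hd⟩ := gh_avoid
    (fun p : {p : Fin m × Fin m // p.1 ≠ p.2} =>
      t p.1.1 • (x p.1.1).rep - t p.1.2 • (x p.1.2).rep) (fun p => hne _ _ p.2)
  let e : Fin m → (MvPolynomial (Fin (n + 1)) F ⧸ ghI V) →+* F := fun i =>
    Ideal.Quotient.lift (ghI V) (eval (t i • (x i).rep)) fun f hf => gh_mem_I.mp hf _ (hx i) _
  have he : ∀ i f, e i (Ideal.Quotient.mk (ghI V) f) = eval (t i • (x i).rep) f := fun i f => rfl
  have hli := gh_li_gen (ghA V c') hφinj hφfin (Ideal.Quotient.mk (ghI V) (ghlin d)) e (eval ε)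
    (by
      intro i a
      have : (e i).comp (ghA V c').toRingHom = eval ε := by
        apply MvPolynomial.ringHom_ext
        · intro b
          rw [eval_C]
          show e i (ghA V c' (C b)) = b
          rw [ghA, algHom_C]
          exact (he i (C b)).trans (eval_C _)
        · intro j
          rw [eval_X]
          show e i (ghA V c' (X j)) = _
          rw [ghA, aeval_X, he]
          exact hε i j
      exact RingHom.congr_fun this a)
    (by
      intro i j hij
      by_contra hne'
      apply hd ⟨(i, j), hne'⟩
      simp only [he, gh_lin_eval] at hij
      simp only [Pi.sub_apply, mul_sub, Finset.sum_sub_distrib]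
      exact sub_eq_zero.mpr hij) _ (gh_li_mon (r + 1) m)
  have hcount := gh_count c N hN ((r + 1) * m + m)
    (fun p : (Fin (r + 1) → Fin (m + 1)) × Fin m =>
      (∏ i, ghlin (c' i) ^ (p.1 i : ℕ)) * ghlin d ^ (p.2 : ℕ))
    (by
      intro p
      have h1 : ((∏ i, ghlin (c' i) ^ (p.1 i : ℕ)) * ghlin d ^ (p.2 : ℕ)).IsHomogeneous
          (∑ i, 1 * (p.1 i : ℕ) + 1 * (p.2 : ℕ)) :=
        (IsHomogeneous.prod _ _ _ fun i _ => (gh_lin_hom _).pow _).mul ((gh_lin_hom _).pow _)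
      refine h1.totalDegree_le.trans ?_
      have h2 : ∑ i, 1 * (p.1 i : ℕ) ≤ ∑ i : Fin (r + 1), m :=
        Finset.sum_le_sum fun i _ => by have := (p.1 i).2; omega
      have h3 := p.2.2
      simp only [Finset.sum_const, Finset.card_univ, Fintype.card_fin, smul_eq_mul] at h2
      omega)
    (by
      have hfun : (fun p : (Fin (r + 1) → Fin (m + 1)) × Fin m => Ideal.Quotient.mk (ghI V)
          ((∏ i, ghlin (c' i) ^ (p.1 i : ℕ)) * ghlin d ^ (p.2 : ℕ))) =
          fun p => ghA V c' (∏ i, X i ^ (p.1 i : ℕ)) *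
            (Ideal.Quotient.mk (ghI V) (ghlin d)) ^ (p.2 : ℕ) := by
        funext p
        simp [ghA]
      rw [hfun]
      exact hli)
  simp only [Fintype.card_prod, Fintype.card_fun, Fintype.card_fin] at hcount
  have h4 : (r + 1) * m + m + 1 ≤ (r + 1 + 1) * (m + 1) := by nlinarith
  have h5 : (m + 1) ^ (r + 1) * m ≤
      (m + 1) ^ (r + 1) * ((r + 1 + 1) ^ (r + 1) * (N + 1) ^ (n + 1)) := by
    refine hcount.trans ?_
    calc ((r + 1) * m + m + 1) ^ (r + 1) * (N + 1) ^ (n + 1)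
        ≤ ((r + 1 + 1) * (m + 1)) ^ (r + 1) * (N + 1) ^ (n + 1) := by gcongr
      _ = _ := by rw [mul_pow]; ring
  exact Nat.le_of_mul_le_mul_left h5 (by positivity)

end AuxD

section AuxE

variable {F} {n : ℕ}

theorem gh_eqns (r : ℕ) (hrn : r ≤ n) (E : Submodule F (Fin (n + 1) → F))
    (hE : Module.finrank F E = n - r + 1) :
    ∃ c : Fin r → Fin (n + 1) → F, ∀ v, v ∈ E ↔ ∀ i, ∑ j, c i j * v j = 0 := by
  have h1 : Module.finrank F ((Fin (n + 1) → F) ⧸ E) = Module.finrank F (Fin r → F) := by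
    have := E.finrank_quotient_add_finrank
    rw [hE] at this
    simp only [Module.finrank_fin_fun] at this ⊢
    omega
  let Φ : (Fin (n + 1) → F) →ₗ[F] (Fin r → F) :=
    (LinearEquiv.ofFinrankEq _ _ h1).toLinearMap ∘ₗ E.mkQ
  have hΦ : ∀ v, v ∈ E ↔ Φ v = 0 := by
    intro v
    simp [Φ]
  refine ⟨fun i j => Φ (Pi.single j 1) i, fun v => ?_⟩
  rw [hΦ, _root_.funext_iff]
  refine forall_congr' fun i => ?_
  have h2 : Φ v i = ∑ j, Φ (Pi.single j 1) i * v j := by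
    have h3 := congrFun (Φ.pi_apply_eq_sum_univ v) i
    rw [h3, Finset.sum_apply]
    refine Finset.sum_congr rfl fun j _ => ?_
    rw [Pi.smul_apply, smul_eq_mul, mul_comm]
    have h4 : (fun k => if j = k then (1 : F) else 0) = Pi.single j 1 := by
      funext k
      simp [Pi.single_apply, eq_comm]
    rw [h4]
  rw [h2]
  rfl

theorem gh_deg_bdd {V : Set (Projectivization F (Fin (n + 1) → F))}
    (hV : IsIrredProjVariety F n V) {r : ℕ} (hr : projDim F n V = r) (hch : ghCh V r)
    (hrn : r ≤ n) :
    BddAbove {m : ℕ | ∃ L, IsProjSubspaceOfDim F n (n - r) L ∧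
      (V ∩ L).Finite ∧ (V ∩ L).ncard = m} := by
  obtain ⟨c, hc⟩ := (gh_dim_iff hV.1 (r + 1)).mpr (by rw [hr]; push_cast; exact le_rfl)
  obtain ⟨N, hN⟩ := gh_key hV.1 c hc
  refine ⟨(r + 1 + 1) ^ (r + 1) * (N + 1) ^ (n + 1), ?_⟩
  rintro m ⟨L, ⟨E, hE, rfl⟩, hfin, hm⟩
  obtain ⟨c', hc'⟩ := gh_eqns r hrn E hE
  have := hfin.to_subtype
  let eq := Finite.equivFinOfCardEq (α := ↥(V ∩ {x | x.rep ∈ E})) (n := m)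
    (by rw [Nat.card_coe_set_eq]; exact hm)
  let x : Fin m → Projectivization F (Fin (n + 1) → F) := fun i => (eq.symm i).1
  have hxV : ∀ i, x i ∈ V := fun i => (eq.symm i).2.1
  have hxE : ∀ i, (x i).rep ∈ E := fun i => (eq.symm i).2.2
  have hsurj : ∀ y ∈ V, y.rep ∈ E → ∃ i, x i = y := fun y hy hyE =>
    ⟨eq ⟨y, hy, hyE⟩, by simp [x]⟩
  obtain ⟨c0, hc0⟩ := gh_avoid (fun i => (x i).rep) (fun i => (x i).rep_nonzero)
  refine gh_bound hV hch c N hN (Fin.cons c0 c') ?_ x hxV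
    (fun i j hij => eq.symm.injective (Subtype.ext hij))
    (fun i => (∑ j, c0 j * (x i).rep j)⁻¹) (fun i => inv_ne_zero (hc0 i)) (Fin.cons 1 0) ?_
  · intro y hy
    by_cases hyE : y.rep ∈ E
    · obtain ⟨i, rfl⟩ := hsurj y hy hyE
      refine ⟨0, ?_⟩
      rw [Fin.cons_zero, gh_lin_eval]
      exact hc0 i
    · rw [hc'] at hyE
      push Not at hyE
      obtain ⟨i, hi⟩ := hyE
      refine ⟨i.succ, ?_⟩
      rw [Fin.cons_succ, gh_lin_eval]
      exact hi
  · intro i j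
    have hs : ∀ (a : F) (w v : Fin (n + 1) → F), eval (a • v) (ghlin w) = a * ∑ j, w j * v j := by
      intro a w v
      rw [gh_lin_eval, Finset.mul_sum]
      refine Finset.sum_congr rfl fun j _ => ?_
      rw [Pi.smul_apply, smul_eq_mul]
      ring
    rw [hs]
    induction j using Fin.cases with
    | zero =>
      rw [Fin.cons_zero, Fin.cons_zero]
      exact inv_mul_cancel₀ (hc0 i)
    | succ j =>
      rw [Fin.cons_succ, Fin.cons_succ, (hc' _).mp (hxE i) j, mul_zero]
      rfl

theorem gh_deg_wit {V : Set (Projectivization F (Fin (n + 1) → F))}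
    (hV : IsIrredProjVariety F n V) {r : ℕ} (hr : projDim F n V = r) (hrn : r ≤ n) :
    ∃ L, IsProjSubspaceOfDim F n (n - r) L ∧ (V ∩ L).Finite ∧ (V ∩ L).Nonempty := by
  obtain ⟨c, hc⟩ := (gh_dim_iff hV.1 (r + 1)).mpr (by rw [hr]; push_cast; exact le_rfl)
  have hno : ∀ c : Fin r → Fin (n + 1) → F, ¬ ghNZ c V := by
    intro c hc
    have := (gh_dim_iff hV.1 r).mp ⟨c, hc⟩
    omega
  let c' : Fin r → Fin (n + 1) → F := fun i => c i.succ
  have hli : LinearIndependent F c' := by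
    rw [Fintype.linearIndependent_iff]
    by_contra hcon
    push Not at hcon
    obtain ⟨g, hg, i0, hi0⟩ := hcon
    apply hno (fun i => c (i0.succ.succAbove i))
    intro x hx
    by_contra hall
    push Not at hall
    have hall' : ∀ j, j ≠ i0.succ → ∑ k, c j k * x.rep k = 0 := by
      intro j hj
      obtain ⟨i, rfl⟩ := Fin.exists_succAbove_eq hj
      rw [← gh_lin_eval]
      exact hall i
    have hz : ∑ k, c i0.succ k * x.rep k = 0 := by
      have h1 : ∑ i, g i * ∑ k, c' i k * x.rep k = 0 := by
        have h2 : ∑ k, (∑ i, g i • c' i) k * x.rep k = 0 := by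
          rw [hg]
          simp
        rw [← h2]
        simp only [Finset.sum_apply, Pi.smul_apply, smul_eq_mul, Finset.mul_sum, Finset.sum_mul]
        rw [Finset.sum_comm]
        simp only [mul_assoc]
      rw [Finset.sum_eq_single i0] at h1
      · exact (mul_eq_zero.mp h1).resolve_left hi0
      · intro b _ hb
        rw [hall' b.succ (fun h => hb (Fin.succ_injective _ h)), mul_zero]
      · simp
    obtain ⟨j, hj⟩ := hc x hx
    rw [gh_lin_eval] at hj
    by_cases h : j = i0.succ
    · rw [h] at hj
      exact hj hz
    · exact hj (hall' j h)
  let E : Submodule F (Fin (n + 1) → F) := LinearMap.ker (Matrix.mulVecLin (Matrix.of c'))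
  have hEmem : ∀ v, v ∈ E ↔ ∀ i, ∑ j, c' i j * v j = 0 := by
    intro v
    rw [LinearMap.mem_ker, Matrix.mulVecLin_apply, _root_.funext_iff]
    rfl
  have hE : Module.finrank F E = n - r + 1 := by
    have h1 := (Matrix.mulVecLin (Matrix.of c')).finrank_range_add_finrank_ker
    have h2 : (Matrix.of c').rank = r := by
      have := LinearIndependent.rank_matrix (M := Matrix.of c') hli
      simpa using this
    rw [Matrix.rank] at h2
    rw [h2, Module.finrank_fin_fun] at h1
    change r + Module.finrank F E = _ at h1
    omega
  refine ⟨{x | x.rep ∈ E}, ⟨E, hE, rfl⟩, ?_, ?_⟩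
  · have hclosed : IsProjVariety F n (V ∩ {x | x.rep ∈ E}) := by
      refine gh_inter_closed hV.1 ⟨Set.range fun i => ghlin (c' i), ?_, ?_⟩
      · rintro _ ⟨i, rfl⟩
        exact ⟨1, gh_lin_hom _⟩
      · ext x
        simp only [Set.mem_ofPred_eq, hEmem, Set.mem_iInter, Set.mem_range, projZeroSet]
        constructor
        · rintro h _ ⟨i, rfl⟩
          rw [gh_lin_eval]
          exact h i
        · intro h i
          rw [← gh_lin_eval]
          exact h _ ⟨i, rfl⟩
    apply gh_finite_of_dim hclosed
    have := (gh_dim_iff hclosed 1).mp ⟨fun _ => c 0, by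
      rintro x ⟨hxV, hxE⟩
      refine ⟨0, ?_⟩
      obtain ⟨j, hj⟩ := hc x hxV
      induction j using Fin.cases with
      | zero => exact hj
      | succ j =>
        rw [gh_lin_eval] at hj
        exact absurd ((hEmem _).mp hxE j) hj⟩
    push_cast at this
    omega
  · by_contra hemp
    apply hno c'
    intro x hx
    by_contra hall
    push Not at hall
    apply hemp
    refine ⟨x, hx, (hEmem _).mpr fun i => ?_⟩
    rw [← gh_lin_eval]
    exact hall i

theorem gh_deg_pos {V : Set (Projectivization F (Fin (n + 1) → F))}
    (hV : IsIrredProjVariety F n V) : 1 ≤ projIrredDegree F n V := by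
  obtain ⟨r, hr, hch, -⟩ := gh_dim_spec V hV.2.1
  have hrn : r ≤ n := by
    have := gh_ch_upper _ (gh_NZ_coord V) r hch
    omega
  obtain ⟨L, hL, hfin, hne⟩ := gh_deg_wit hV hr hrn
  have hb := gh_deg_bdd hV hr hch hrn
  rw [projIrredDegree, hr, Int.toNat_natCast]
  exact ((Set.ncard_pos hfin).mpr hne).trans_le (le_csSup hb ⟨L, hL, hfin, rfl⟩)

/-- The univariate polynomial whose value at `γ` is the linear form evaluated at `v`. -/
noncomputable def ghQ (v : Fin (n + 1) → F) : Polynomial F :=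
  ∑ j : Fin (n + 1), Polynomial.C (v j) * Polynomial.X ^ (j : ℕ)

theorem gh_Q_ne (v : Fin (n + 1) → F) (hv : v ≠ 0) : ghQ v ≠ 0 := by
  intro h0
  apply hv
  ext j
  have := congrArg (fun p => Polynomial.coeff p (j : ℕ)) h0
  simp only [ghQ, Polynomial.finsetSum_coeff, Polynomial.coeff_C_mul_X_pow,
    Polynomial.coeff_zero] at this
  rw [Finset.sum_eq_single j] at this
  · simpa using this
  · intro b _ hb
    rw [if_neg]
    intro h
    exact hb (Fin.ext h.symm)
  · simp

theorem gh_Q_deg (v : Fin (n + 1) → F) : (ghQ v).natDegree ≤ n := by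
  refine Polynomial.natDegree_sum_le_of_forall_le _ _ fun j _ => ?_
  exact (Polynomial.natDegree_C_mul_X_pow_le _ _).trans (by have := j.2; omega)

theorem gh_Q_eval (v : Fin (n + 1) → F) (γ : F) :
    (ghQ v).eval γ = eval v (linForm F n γ) := by
  simp only [ghQ, linForm, Polynomial.eval_finsetSum, Polynomial.eval_mul, Polynomial.eval_C,
    Polynomial.eval_pow, Polynomial.eval_X, map_sum, map_mul, eval_C, eval_X]
  exact Finset.sum_congr rfl fun j _ => mul_comm _ _

end AuxE


/-- For a nonempty projective variety `V ⊆ ℙ^n` of degree `d`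
there is a nonzero univariate polynomial `P` of degree at most `nd` such that for
every `γ` with `P(γ) ≠ 0`, the hyperplane `V(x₀ + γx₁ + ⋯ + γⁿxₙ)` cuts every
irreducible component of `V` in dimension exactly one less. -/
theorem generic_hyperplane_section_projective (n d : ℕ)
    (V : Set (Projectivization F (Fin (n + 1) → F)))
    (hV : IsProjVariety F n V) (hne : V.Nonempty) (hdeg : projDegree F n V = d) :
    ∃ P : Polynomial F, P ≠ 0 ∧ P.natDegree ≤ n * d ∧
      ∀ γ : F, Polynomial.eval γ P ≠ 0 →
        ∀ Vi, IsProjIrredComponent F n Vi V →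
          projDim F n (Vi ∩ projZeroSet F n (linForm F n γ)) = projDim F n Vi - 1 := by
  have hcomp := gh_components_finite hV
  have hpt : ∀ W : Set (Projectivization F (Fin (n + 1) → F)),
      ∃ p : Projectivization F (Fin (n + 1) → F), IsProjIrredComponent F n W V → p ∈ W := by
    intro W
    by_cases h : W.Nonempty
    · exact ⟨h.some, fun _ => h.some_mem⟩
    · exact ⟨hne.some, fun hW => absurd hW.1.2.1 h⟩
  choose p hp using hpt
  refine ⟨∏ W ∈ hcomp.toFinset, ghQ (p W).rep, ?_, ?_, ?_⟩
  · exact Finset.prod_ne_zero_iff.mpr fun W _ => gh_Q_ne _ (p W).rep_nonzero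
  · refine (Polynomial.natDegree_prod_le _ _).trans ?_
    rw [← hdeg, projDegree, finsum_mem_eq_finite_toFinset_sum _ hcomp, Finset.mul_sum]
    refine Finset.sum_le_sum fun W hW => (gh_Q_deg _).trans ?_
    have hW' : IsProjIrredComponent F n W V := by simpa using hW
    exact Nat.le_mul_of_pos_right n (gh_deg_pos hW'.1)
  · intro γ hγ Vi hVi
    rw [Polynomial.eval_prod, Finset.prod_ne_zero_iff] at hγ
    have h1 := hγ Vi (by simpa using hVi)
    rw [gh_Q_eval] at h1
    exact gh_section hVi.1 (fun j : Fin (n + 1) => γ ^ (j : ℕ)) fun hsub => h1 (hsub (hp Vi hVi))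
end

section
/- Let V ⊆ A^n be a nonempty affine variety of degree d with irreducible components V_1, …, V_t. There exists a nonzero univariate polynomial P ∈ F[z] of degree at most nd such that for every γ ∈ F with P(γ) ≠ 0 and for every i ∈ {1, …, t}, the intersection V_i ∩ V(1 + γx_1 + γ^2 x_2 + ⋯ + γ^n x_n) has dimension exactly dim V_i − 1; in particular, if dim V_i = 0 then this intersection is empty (where dim ∅ = −1). -/
open MvPolynomial Classical

variable (F : Type) [Field F] [IsAlgClosed F]



/-- The zero set in `𝔸^n` of a polynomial in `n` variables. -/
def affZeroSet (n : ℕ) (f : MvPolynomial (Fin n) F) : Set (Fin n → F) :=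
  {x | MvPolynomial.eval x f = 0}

/-- An affine variety in `𝔸^n`: the common zero set of a family of polynomials. -/
def IsAffVariety (n : ℕ) (V : Set (Fin n → F)) : Prop :=
  ∃ S : Set (MvPolynomial (Fin n) F), V = ⋂ f ∈ S, affZeroSet F n f

/-- An irreducible affine variety. -/
def IsIrredAffVariety (n : ℕ) (V : Set (Fin n → F)) : Prop :=
  IsAffVariety F n V ∧ V.Nonempty ∧
    ∀ A B : Set (Fin n → F),
      IsAffVariety F n A → IsAffVariety F n B → V ⊆ A ∪ B → V ⊆ A ∨ V ⊆ B

/-- `W` is an irreducible component of the affine variety `V`. -/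
def IsAffIrredComponent (n : ℕ) (W V : Set (Fin n → F)) : Prop :=
  IsIrredAffVariety F n W ∧ W ⊆ V ∧
    ∀ W', IsIrredAffVariety F n W' → W ⊆ W' → W' ⊆ V → W' = W

/-- Dimension of an affine variety, as the longest chain of irreducible
subvarieties; the empty set has dimension `-1`. -/
noncomputable def affDim (n : ℕ) (V : Set (Fin n → F)) : ℤ :=
  if V.Nonempty then
    ((sSup {m : ℕ | ∃ W : Fin (m + 1) → Set (Fin n → F),
      (∀ i, IsIrredAffVariety F n (W i) ∧ W i ⊆ V) ∧
      ∀ i j, i < j → W i ⊂ W j} : ℕ) : ℤ)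
  else -1

/-- `L` is an affine subspace of dimension `k` in `𝔸^n`. -/
def IsAffSubspaceOfDim (n k : ℕ) (L : Set (Fin n → F)) : Prop :=
  ∃ A : AffineSubspace F (Fin n → F), (A : Set (Fin n → F)).Nonempty ∧
    Module.finrank F A.direction = k ∧ L = (A : Set (Fin n → F))

/-- Degree of an irreducible affine variety: the largest finite number of points
in its intersection with an affine subspace of complementary dimension. -/
noncomputable def affIrredDegree (n : ℕ) (V : Set (Fin n → F)) : ℕ :=
  sSup {m : ℕ | ∃ L, IsAffSubspaceOfDim F n (n - (affDim F n V).toNat) L ∧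
    (V ∩ L).Finite ∧ (V ∩ L).ncard = m}

/-- Degree of an affine variety: the sum of the degrees of its irreducible
components. -/
noncomputable def affDegree (n : ℕ) (V : Set (Fin n → F)) : ℕ :=
  ∑ᶠ W ∈ {W | IsAffIrredComponent F n W V}, affIrredDegree F n W

/-- `W` strongly evades `V` if for every irreducible component `Vᵢ` of `V` one has
`dim (Vᵢ ∩ W) ≤ dim Vᵢ + dim W - n`, with equality whenever the right-hand side
is nonnegative. -/
def StronglyEvades (n : ℕ) (W V : Set (Fin n → F)) : Prop :=
  ∀ Vi, IsAffIrredComponent F n Vi V →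
    affDim F n (Vi ∩ W) ≤ affDim F n Vi + affDim F n W - (n : ℤ) ∧
    (0 ≤ affDim F n Vi + affDim F n W - (n : ℤ) →
      affDim F n (Vi ∩ W) = affDim F n Vi + affDim F n W - (n : ℤ))

/-- The affine linear polynomial `1 + α x₁ + α² x₂ + ⋯ + αⁿ xₙ`. -/
noncomputable def affLinForm (n : ℕ) (α : F) : MvPolynomial (Fin n) F :=
  MvPolynomial.C 1 + ∑ j : Fin n, MvPolynomial.C (α ^ ((j : ℕ) + 1)) * MvPolynomial.X j



section Bound
variable {F : Type} [Field F] [IsAlgClosed F]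

/-- Fibres of a constructible family of subsets of the line. -/
lemma cds_fiber_bound {σ : Type} (C : PrimeSpectrum.BasicConstructibleSetData (Polynomial (MvPolynomial σ F))) :
    ∃ N : ℕ, ∀ p : σ → F, 
      {a : F | (∀ i, Polynomial.eval a ((C.g i).map (MvPolynomial.eval p)) = 0) ∧ 
        Polynomial.eval a (C.f.map (MvPolynomial.eval p)) ≠ 0}.Finite →
      {a : F | (∀ i, Polynomial.eval a ((C.g i).map (MvPolynomial.eval p)) = 0) ∧ 
        Polynomial.eval a (C.f.map (MvPolynomial.eval p)) ≠ 0}.ncard ≤ N := by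
  refine ⟨∑ i, (C.g i).natDegree, fun p hfin => ?_⟩
  by_cases h : ∃ i, (C.g i).map (MvPolynomial.eval p) ≠ 0
  · obtain ⟨i, hi⟩ := h
    calc _ ≤ (((C.g i).map (MvPolynomial.eval p)).roots.toFinset : Set F).ncard := by
            apply Set.ncard_le_ncard _ (Finset.finite_toSet _)
            intro a ha
            simp [hi]
            exact ha.1 i
      _ ≤ (C.g i).natDegree := by
            rw [Set.ncard_coe_finset]
            exact (Multiset.toFinset_card_le _).trans ((Polynomial.card_roots' _).trans Polynomial.natDegree_map_le)
      _ ≤ _ := Finset.single_le_sum (f := fun i => (C.g i).natDegree) (fun _ _ => Nat.zero_le _) (Finset.mem_univ i)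
  · push Not at h
    by_cases hf : C.f.map (MvPolynomial.eval p) = 0
    · simp [hf]
    · exfalso
      have hinf : (Set.univ : Set F).Infinite := Set.infinite_univ
      apply hinf
      apply (hfin.union (Finset.finite_toSet (C.f.map (MvPolynomial.eval p)).roots.toFinset)).subset
      intro a _
      by_cases ha : Polynomial.eval a (C.f.map (MvPolynomial.eval p)) = 0
      · right; simp [hf]; exact ha
      · left; exact ⟨fun i => by simp [h i], ha⟩

lemma prime_mem_image_iff {σ τ ι : Type} [Finite σ] [Finite τ] (f : ι → MvPolynomial (σ ⊕ τ) F) (j : τ)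
    (p : σ → F) (a : F) (y : PrimeSpectrum (Polynomial (MvPolynomial σ F)))
    (hy : y.asIdeal = RingHom.ker (Polynomial.eval₂RingHom (MvPolynomial.eval p) a)) :
    y ∈ (PrimeSpectrum.comap (Polynomial.eval₂RingHom (MvPolynomial.rename (R := F) (Sum.inl : σ → σ ⊕ τ)).toRingHom
        (X (Sum.inr j)))) '' PrimeSpectrum.zeroLocus (Set.range f) ↔
      ∃ x : τ → F, (∀ i, MvPolynomial.eval (Sum.elim p x) (f i) = 0) ∧ x j = a := by
  set ψ := (Polynomial.eval₂RingHom (MvPolynomial.rename (R := F) (Sum.inl : σ → σ ⊕ τ)).toRingHom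
        (X (Sum.inr j) : MvPolynomial (σ ⊕ τ) F)) with hψ
  have key : ∀ x : τ → F, x j = a → 
      (MvPolynomial.eval (Sum.elim p x)).comp ψ = Polynomial.eval₂RingHom (MvPolynomial.eval p) a := by
    intro x hx
    apply Polynomial.ringHom_ext'
    · apply MvPolynomial.ringHom_ext
      · intro r; simp [hψ]
      · intro i; simp [hψ]
    · simp [hψ, hx]
  constructor
  · rintro ⟨Q, hQ, rfl⟩
    obtain ⟨M, hM, hQM⟩ := Ideal.exists_le_maximal Q.asIdeal Q.isPrime.ne_top
    obtain ⟨z, hz⟩ := (MvPolynomial.isMaximal_iff_eq_vanishingIdeal_singleton (K := F)).1 hM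
    have hmax : (RingHom.ker (Polynomial.eval₂RingHom (MvPolynomial.eval p) a)).IsMaximal := by
      apply RingHom.ker_isMaximal_of_surjective
      intro c
      exact ⟨Polynomial.C (C c), by simp⟩
    have h1 : RingHom.ker (Polynomial.eval₂RingHom (MvPolynomial.eval p) a) ≤ M.comap ψ := by
      rw [← hy]; exact Ideal.comap_mono hQM
    have memM : ∀ q, q ∈ M ↔ MvPolynomial.eval z q = 0 := by
      intro q; rw [hz, MvPolynomial.mem_vanishingIdeal_singleton_iff]; simp [MvPolynomial.aeval_eq_eval]
    have hp : ∀ i, z (Sum.inl i) = p i := by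
      intro i
      have : (Polynomial.C (X i - C (p i))) ∈ M.comap ψ := h1 (by simp [RingHom.mem_ker])
      rw [Ideal.mem_comap, memM] at this
      simpa [hψ, sub_eq_zero] using this
    have ha : z (Sum.inr j) = a := by
      have : (Polynomial.X - Polynomial.C (C a)) ∈ M.comap ψ := h1 (by simp [RingHom.mem_ker])
      rw [Ideal.mem_comap, memM] at this
      simpa [hψ, sub_eq_zero] using this
    refine ⟨fun k => z (Sum.inr k), fun i => ?_, ha⟩
    have : Sum.elim p (fun k => z (Sum.inr k)) = z := by
      funext k; cases k <;> simp [hp]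
    rw [this, ← memM]
    exact hQM (hQ ⟨i, rfl⟩)
  · rintro ⟨x, hx, hxa⟩
    refine ⟨⟨RingHom.ker (MvPolynomial.eval (Sum.elim p x)), RingHom.ker_isPrime _⟩, ?_, ?_⟩
    · rintro _ ⟨i, rfl⟩
      exact hx i
    · ext1
      rw [hy, ← key x hxa]
      rfl

/-- Uniform bound for the finite fibres of a family of affine varieties. -/
lemma uniform_fiber_bound {σ τ ι : Type} [Finite σ] [Finite τ] [Finite ι] (f : ι → MvPolynomial (σ ⊕ τ) F) :
    ∃ N : ℕ, ∀ p : σ → F, {x : τ → F | ∀ i, MvPolynomial.eval (Sum.elim p x) (f i) = 0}.Finite →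
      {x : τ → F | ∀ i, MvPolynomial.eval (Sum.elim p x) (f i) = 0}.ncard ≤ N := by
  have := Fintype.ofFinite τ
  have coord : ∀ j : τ, ∃ N : ℕ, ∀ p : σ → F, 
      ((fun x : τ → F => x j) '' {x : τ → F | ∀ i, MvPolynomial.eval (Sum.elim p x) (f i) = 0}).Finite →
      ((fun x : τ → F => x j) '' {x : τ → F | ∀ i, MvPolynomial.eval (Sum.elim p x) (f i) = 0}).ncard ≤ N := by
    intro j
    set ψ := (Polynomial.eval₂RingHom (MvPolynomial.rename (R := F) (Sum.inl : σ → σ ⊕ τ)).toRingHom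
        (X (Sum.inr j) : MvPolynomial (σ ⊕ τ) F)) with hψ
    have hfp : ψ.FinitePresentation := by
      rw [← RingHom.FinitePresentation.of_finiteType]
      apply RingHom.FiniteType.of_comp_finiteType (f := algebraMap F (Polynomial (MvPolynomial σ F)))
      have : ψ.comp (algebraMap F (Polynomial (MvPolynomial σ F))) = algebraMap F (MvPolynomial (σ ⊕ τ) F) := by
        ext c; simp [hψ, Polynomial.algebraMap_apply, MvPolynomial.algebraMap_eq]
      rw [this, RingHom.finiteType_algebraMap]
      infer_instance
    have hcons : Topology.IsConstructible (PrimeSpectrum.zeroLocus (Set.range f)) := by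
      rw [← Topology.isConstructible_compl]
      exact (PrimeSpectrum.isRetrocompact_zeroLocus_compl (Set.finite_range _)).isConstructible
        (PrimeSpectrum.isClosed_zeroLocus _).isOpen_compl
    obtain ⟨S, hS⟩ := PrimeSpectrum.exists_constructibleSetData_iff.2 (PrimeSpectrum.isConstructible_comap_image hfp hcons)
    choose N hN using (fun C : PrimeSpectrum.BasicConstructibleSetData (Polynomial (MvPolynomial σ F)) => cds_fiber_bound C)
    refine ⟨∑ C ∈ S, N C, fun p hfin => ?_⟩
    have heq : ((fun x : τ → F => x j) '' {x : τ → F | ∀ i, MvPolynomial.eval (Sum.elim p x) (f i) = 0})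
        = ⋃ C ∈ S, {a : F | (∀ i, Polynomial.eval a ((C.g i).map (MvPolynomial.eval p)) = 0) ∧ 
        Polynomial.eval a (C.f.map (MvPolynomial.eval p)) ≠ 0} := by
      ext a
      have h1 := prime_mem_image_iff f j p a ⟨_, RingHom.ker_isPrime _⟩ rfl
      rw [← hS] at h1
      have h2 : a ∈ ((fun x : τ → F => x j) '' {x : τ → F | ∀ i, MvPolynomial.eval (Sum.elim p x) (f i) = 0}) ↔ 
        ∃ x : τ → F, (∀ i, MvPolynomial.eval (Sum.elim p x) (f i) = 0) ∧ x j = a := Iff.rfl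
      rw [h2, ← h1]
      simp only [PrimeSpectrum.ConstructibleSetData.toSet, PrimeSpectrum.BasicConstructibleSetData.toSet,
        Set.mem_iUnion, Set.mem_sdiff, PrimeSpectrum.mem_zeroLocus, Set.range_subset_iff, 
        Set.singleton_subset_iff, SetLike.mem_coe, RingHom.mem_ker, Set.mem_ofPred_eq, 
        Polynomial.eval_map, Polynomial.coe_eval₂RingHom]
    rw [heq] at hfin ⊢
    refine (Finset.set_ncard_biUnion_le _ _).trans (Finset.sum_le_sum fun C hC => hN C p ?_)
    exact hfin.subset (Set.subset_biUnion_of_mem (u := fun C : PrimeSpectrum.BasicConstructibleSetData (Polynomial (MvPolynomial σ F)) => {a : F | (∀ i, Polynomial.eval a ((C.g i).map (MvPolynomial.eval p)) = 0) ∧ 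
        Polynomial.eval a (C.f.map (MvPolynomial.eval p)) ≠ 0}) hC)
  choose N hN using coord
  refine ⟨∏ j, N j, fun p hfin => ?_⟩
  set Z := {x : τ → F | ∀ i, MvPolynomial.eval (Sum.elim p x) (f i) = 0}
  have hf : ∀ j, ((fun x : τ → F => x j) '' Z).Finite := fun j => hfin.image _
  calc Z.ncard ≤ (Fintype.piFinset (fun j => (hf j).toFinset) : Set (τ → F)).ncard := by
        apply Set.ncard_le_ncard _ (Finset.finite_toSet _)
        intro x hx
        simp only [Finset.mem_coe, Fintype.mem_piFinset, Set.Finite.mem_toFinset]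
        intro j
        exact ⟨x, hx, rfl⟩
    _ = ∏ j, ((fun x : τ → F => x j) '' Z).ncard := by
        rw [Set.ncard_coe_finset, Fintype.card_piFinset]
        refine Finset.prod_congr rfl fun j _ => ?_
        rw [Set.ncard_eq_toFinset_card _ (hf j)]
    _ ≤ _ := Finset.prod_le_prod' fun j _ => hN j p (hf j)

end Bound


set_option linter.unusedSectionVars false

section Dict
variable {F : Type} [Field F] [IsAlgClosed F] {n : ℕ}

lemma affVariety_iff {V : Set (Fin n → F)} :
    IsAffVariety F n V ↔ zeroLocus F (vanishingIdeal F V) = V := by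
  constructor
  · rintro ⟨S, rfl⟩
    apply le_antisymm _ (zeroLocus_vanishingIdeal_le _)
    intro x hx
    simp only [Set.mem_iInter]
    intro f hf
    have := hx f (by
      rw [mem_vanishingIdeal_iff]
      intro y hy
      simp only [Set.mem_iInter] at hy
      simpa [aeval_eq_eval, affZeroSet] using hy f hf)
    simpa [aeval_eq_eval, affZeroSet] using this
  · intro h
    refine ⟨vanishingIdeal F V, ?_⟩
    conv_lhs => rw [← h]
    ext x
    simp [mem_zeroLocus_iff, affZeroSet, aeval_eq_eval]

lemma affVariety_zeroLocus (J : Ideal (MvPolynomial (Fin n) F)) :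
    IsAffVariety F n (zeroLocus F J) := by
  refine ⟨J, ?_⟩
  ext x
  simp [mem_zeroLocus_iff, affZeroSet, aeval_eq_eval]

lemma irred_prime {V : Set (Fin n → F)} (h : IsIrredAffVariety F n V) :
    (vanishingIdeal F V).IsPrime := by
  obtain ⟨hv, ⟨x, hx⟩, hirr⟩ := h
  constructor
  · intro htop
    have : (1 : MvPolynomial (Fin n) F) ∈ vanishingIdeal F V := by rw [htop]; trivial
    rw [mem_vanishingIdeal_iff] at this
    simpa using this x hx
  · intro f g hfg
    have := hirr (affZeroSet F n f) (affZeroSet F n g) ⟨{f}, by simp⟩ ⟨{g}, by simp⟩ (by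
      intro y hy
      have := (mem_vanishingIdeal_iff.1 hfg) y hy
      simpa [affZeroSet, aeval_eq_eval] using this)
    refine this.imp ?_ ?_ <;>
    · intro h
      rw [mem_vanishingIdeal_iff]
      intro y hy
      simpa [affZeroSet, aeval_eq_eval] using h hy

lemma prime_irred (P : Ideal (MvPolynomial (Fin n) F)) (hP : P.IsPrime) :
    IsIrredAffVariety F n (zeroLocus F P) := by
  have hvan : vanishingIdeal F (zeroLocus F P) = P := IsPrime.vanishingIdeal_zeroLocus P
  refine ⟨affVariety_zeroLocus P, ?_, ?_⟩
  · by_contra hne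
    rw [Set.not_nonempty_iff_eq_empty] at hne
    rw [hne, vanishingIdeal_empty] at hvan
    exact hP.ne_top hvan.symm
  · intro A B hA hB hAB
    rw [affVariety_iff] at hA hB
    rw [← hA, ← hB]
    by_contra hcon
    push Not at hcon
    obtain ⟨h1, h2⟩ := hcon
    rw [Set.not_subset] at h1 h2
    obtain ⟨a, haP, ha⟩ := h1
    obtain ⟨b, hbP, hb⟩ := h2
    rw [mem_zeroLocus_iff] at ha hb
    push Not at ha hb
    obtain ⟨f, hf, hfa⟩ := ha
    obtain ⟨g, hg, hgb⟩ := hb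
    have : f * g ∈ P := by
      rw [← hvan, mem_vanishingIdeal_iff]
      intro x hx
      rw [map_mul]
      rcases hAB hx with h | h
      · rw [(mem_vanishingIdeal_iff.1 hf) x h, zero_mul]
      · rw [(mem_vanishingIdeal_iff.1 hg) x h, mul_zero]
    rcases hP.mem_or_mem this with h | h
    · exact hfa (haP f h)
    · exact hgb (hbP g h)

/-- The dimension of a nonempty zero locus is the Krull dimension of the quotient ring. -/
lemma affDim_zeroLocus (J : Ideal (MvPolynomial (Fin n) F)) (hne : (zeroLocus F J).Nonempty) (m : ℕ)
    (hm : ringKrullDim (MvPolynomial (Fin n) F ⧸ J) = m) : affDim F n (zeroLocus F J) = m := by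
  rw [affDim, if_pos hne]
  congr 1
  rw [ringKrullDim_quotient] at hm
  have hset : {k : ℕ | ∃ W : Fin (k + 1) → Set (Fin n → F),
      (∀ i, IsIrredAffVariety F n (W i) ∧ W i ⊆ zeroLocus F J) ∧
      ∀ i j, i < j → W i ⊂ W j} = 
      {k : ℕ | ∃ s : LTSeries (PrimeSpectrum.zeroLocus (J : Set (MvPolynomial (Fin n) F))), s.length = k} := by
    ext k
    constructor
    · rintro ⟨W, hW, hlt⟩
      refine ⟨LTSeries.mk k (fun i => ⟨⟨vanishingIdeal F (W i.rev), irred_prime (hW _).1⟩, ?_⟩) ?_, rfl⟩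
      · exact (le_zeroLocus_iff_le_vanishingIdeal).1 (hW _).2
      · intro i j hij
        have := hlt j.rev i.rev (Fin.rev_lt_rev.2 hij)
        refine lt_of_le_of_ne (vanishingIdeal_anti_mono this.1) ?_
        intro heq
        have h1 : vanishingIdeal F (W i.rev) = vanishingIdeal F (W j.rev) := 
          congrArg (fun z : PrimeSpectrum.zeroLocus (J : Set (MvPolynomial (Fin n) F)) => z.1.asIdeal) heq
        have h2 := affVariety_iff.1 (hW i.rev).1.1
        have h3 := affVariety_iff.1 (hW j.rev).1.1
        rw [h1, h3] at h2
        exact this.ne h2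
    · rintro ⟨s, rfl⟩
      refine ⟨fun i => zeroLocus F (s i.rev).1.asIdeal, fun i => ⟨prime_irred _ (s i.rev).1.2, 
        zeroLocus_anti_mono (s i.rev).2⟩, ?_⟩
      intro i j hij
      have hlt : s j.rev < s i.rev := s.strictMono (Fin.rev_lt_rev.2 hij)
      refine lt_of_le_of_ne (zeroLocus_anti_mono hlt.le) ?_
      intro heq
      have h1 := IsPrime.vanishingIdeal_zeroLocus (K := F) (s i.rev).1.asIdeal (h := (s i.rev).1.2)
      have h2 := IsPrime.vanishingIdeal_zeroLocus (K := F) (s j.rev).1.asIdeal (h := (s j.rev).1.2)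
      simp only at heq
      rw [heq, h2] at h1
      apply hlt.ne
      ext1; ext1
      exact h1
  rw [hset]
  have hbdd : ∀ s : LTSeries (PrimeSpectrum.zeroLocus (J : Set (MvPolynomial (Fin n) F))), s.length ≤ m := by
    intro s
    have := Order.LTSeries.length_le_krullDim s
    rw [hm] at this
    exact_mod_cast this
  obtain ⟨s, hs⟩ := Order.le_krullDim_iff.1 hm.ge
  apply le_antisymm
  · refine csSup_le ⟨s.length, s, rfl⟩ ?_
    rintro k ⟨s, rfl⟩
    exact hbdd s
  · exact le_csSup ⟨m, by rintro k ⟨s, rfl⟩; exact hbdd s⟩ ⟨s, hs⟩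

/-- Finite linear sections of a variety have bounded size. -/
lemma section_bound (W : Set (Fin n → F)) (hW : IsAffVariety F n W) (k : ℕ) :
    ∃ N : ℕ, ∀ L, IsAffSubspaceOfDim F n k L → (W ∩ L).Finite → (W ∩ L).ncard ≤ N := by
  obtain ⟨S, hS⟩ : (vanishingIdeal F W).FG := IsNoetherian.noetherian _
  have hWS : ∀ x, x ∈ W ↔ ∀ f : S, MvPolynomial.eval x f.1 = 0 := by
    intro x
    rw [affVariety_iff] at hW
    conv_lhs => rw [← hW, ← hS, zeroLocus_span]
    simp [aeval_eq_eval]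
  let f : S ⊕ Fin n → MvPolynomial (((Fin n × Fin n) ⊕ Fin n) ⊕ Fin n) F := 
    Sum.elim (fun f => rename Sum.inr f.1) 
      (fun i => ∑ j, X (Sum.inl (Sum.inl (i, j))) * X (Sum.inr j) - X (Sum.inl (Sum.inr i)))
  obtain ⟨N, hN⟩ := uniform_fiber_bound f
  refine ⟨N, ?_⟩
  rintro L ⟨A, ⟨p, hp⟩, -, rfl⟩ hfin
  obtain ⟨E, hE⟩ := Submodule.exists_isCompl A.direction
  let g : (Fin n → F) →ₗ[F] (Fin n → F) := E.subtype ∘ₗ E.projectionOnto A.direction hE.symm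
  have hg : ∀ v, g v = 0 ↔ v ∈ A.direction := by
    intro v
    rw [← LinearMap.mem_ker, LinearMap.ker_comp_of_ker_eq_bot _ (Submodule.ker_subtype _), 
      Submodule.ker_projectionOnto]
  have hA : ∀ x, x ∈ A ↔ g x = g p := by
    intro x
    rw [← sub_eq_zero, ← map_sub, hg]
    rw [← vsub_eq_sub, AffineSubspace.vsub_right_mem_direction_iff_mem hp]
  have heq : W ∩ (A : Set (Fin n → F)) = {x | ∀ i, MvPolynomial.eval (Sum.elim 
      (Sum.elim (fun ij : Fin n × Fin n => LinearMap.toMatrix' g ij.1 ij.2) (g p)) x) (f i) = 0} := by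
    ext x
    have hgx : ∀ i, g x i = ∑ j, LinearMap.toMatrix' g i j * x j := by
      intro i
      conv_lhs => rw [← LinearMap.toMatrix'_mulVec]
      rfl
    have h1 : ∀ s : S, MvPolynomial.eval (Sum.elim 
      (Sum.elim (fun ij : Fin n × Fin n => LinearMap.toMatrix' g ij.1 ij.2) (g p)) x) (f (Sum.inl s)) = 
        MvPolynomial.eval x s.1 := by
      intro s
      simp only [f, Sum.elim_inl, eval_rename]
      rfl
    simp only [Set.mem_inter_iff, hWS, SetLike.mem_coe, hA, Set.mem_ofPred_eq, Sum.forall, h1]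
    apply and_congr Iff.rfl
    rw [_root_.funext_iff]
    apply forall_congr'
    intro i
    simp [f, hgx, sub_eq_zero]
  rw [heq] at hfin ⊢
  exact hN _ hfin

/-- A variety has finitely many components. -/
lemma finite_components (V : Set (Fin n → F)) (hV : IsAffVariety F n V) : 
    {W | IsAffIrredComponent F n W V}.Finite := by
  have hfin : (vanishingIdeal F V).minimalPrimes.Finite := Ideal.finite_minimalPrimes_of_isNoetherianRing _ _
  refine Set.Finite.of_finite_image (f := vanishingIdeal F) (hfin.subset ?_) ?_
  · rintro _ ⟨W, ⟨hW, hWV, hmax⟩, rfl⟩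
    refine ⟨⟨irred_prime hW, vanishingIdeal_anti_mono hWV⟩, ?_⟩
    rintro P ⟨hP, hVP⟩ hPW
    have h1 := hmax (zeroLocus F P) (prime_irred P hP) 
      ((le_zeroLocus_iff_le_vanishingIdeal).2 hPW) 
      (by rw [← affVariety_iff.1 hV]; exact zeroLocus_anti_mono hVP)
    rw [← h1, IsPrime.vanishingIdeal_zeroLocus]
  · intro W hW W' hW' h
    have h1 := affVariety_iff.1 hW.1.1
    have h2 := affVariety_iff.1 hW'.1.1
    rw [← h1, ← h2, h]

end Dict


section Dim
variable {F : Type} [Field F] [IsAlgClosed F]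

/-- Maximal ideals of polynomial rings over an algebraically closed field have full height. -/
lemma mvPoly_height_maximal (r : ℕ) (M : Ideal (MvPolynomial (Fin r) F)) (hM : M.IsMaximal) :
    M.height = r := by
  have hdim : ringKrullDim (MvPolynomial (Fin r) F) = r := by
    rw [MvPolynomial.ringKrullDim_of_isNoetherianRing]; simp
  have : FiniteRingKrullDim (MvPolynomial (Fin r) F) := by
    rw [finiteRingKrullDim_iff_ne_bot_and_top, hdim]
    exact ⟨WithBot.coe_ne_bot, by
      intro h
      have : ((r : ℕ∞) : WithBot ℕ∞) = ((⊤ : ℕ∞) : WithBot ℕ∞) := h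
      rw [WithBot.coe_inj] at this
      exact ENat.natCast_ne_top r this⟩
  obtain ⟨M', hM', hh⟩ := Ideal.exists_isMaximal_height (R := MvPolynomial (Fin r) F)
  rw [hdim] at hh
  have hh' : M'.height = r := by exact_mod_cast hh
  obtain ⟨a, ha⟩ := (MvPolynomial.isMaximal_iff_eq_vanishingIdeal_singleton (K := F)).1 hM
  obtain ⟨b, hb⟩ := (MvPolynomial.isMaximal_iff_eq_vanishingIdeal_singleton (K := F)).1 hM'
  let e : MvPolynomial (Fin r) F ≃ₐ[F] MvPolynomial (Fin r) F := 
    AlgEquiv.ofAlgHom (aeval fun i => X i + C (b i - a i)) (aeval fun i => X i - C (b i - a i))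
      (by ext i; simp [MvPolynomial.algebraMap_eq]) (by ext i; simp [MvPolynomial.algebraMap_eq])
  have hcm : M'.comap (e : MvPolynomial (Fin r) F ≃+* MvPolynomial (Fin r) F).symm = M := by
    ext p
    rw [Ideal.mem_comap, ha, hb, mem_vanishingIdeal_singleton_iff, mem_vanishingIdeal_singleton_iff]
    have : (aeval b).comp (e.symm : MvPolynomial (Fin r) F →ₐ[F] MvPolynomial (Fin r) F) = aeval a := by
      ext i
      simp [e]
    rw [← this]
    rfl
  rw [← hcm, RingEquiv.height_comap, hh']

lemma le_height_maximal (F : Type) [Field F] [IsAlgClosed F] (r : ℕ) {A : Type} [CommRing A] [IsDomain A] [IsNoetherianRing A]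
    [Algebra (MvPolynomial (Fin r) F) A] [FaithfulSMul (MvPolynomial (Fin r) F) A]
    [Algebra.IsIntegral (MvPolynomial (Fin r) F) A] (M : Ideal A) (hM : M.IsMaximal) : (r : ℕ∞) ≤ M.height := by
  have : (M.under (MvPolynomial (Fin r) F)).IsMaximal := Ideal.isMaximal_comap_of_isIntegral_of_isMaximal M
  rw [Ideal.height_eq_height_add_of_liesOver_of_hasGoingDown (M.under (MvPolynomial (Fin r) F)) M, 
    mvPoly_height_maximal r _ this]
  exact le_self_add

lemma dim_of_integral (F : Type) [Field F] [IsAlgClosed F] (r : ℕ) {A : Type} [CommRing A] [IsDomain A] [IsNoetherianRing A]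
    [Algebra (MvPolynomial (Fin r) F) A] [FaithfulSMul (MvPolynomial (Fin r) F) A]
    [Algebra.IsIntegral (MvPolynomial (Fin r) F) A] : ringKrullDim A = r := by
  apply le_antisymm
  · have hdim : ringKrullDim (MvPolynomial (Fin r) F) = r := by
      rw [MvPolynomial.ringKrullDim_of_isNoetherianRing]; simp
    rw [← hdim]
    refine Order.krullDim_le_of_strictMono (PrimeSpectrum.comap (algebraMap (MvPolynomial (Fin r) F) A)) ?_
    intro p q hpq
    exact Ideal.IsIntegral.comap_lt_comap hpq
  · obtain ⟨M, hM⟩ := Ideal.exists_maximal A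
    have h1 := le_height_maximal (F := F) (r := r) M hM
    refine le_trans ?_ (Ideal.height_le_ringKrullDim_of_isPrime (I := M))
    exact_mod_cast h1

lemma dim_quotient_of_integral (F : Type) [Field F] [IsAlgClosed F] (r : ℕ) {A : Type} [CommRing A] [IsDomain A] [IsNoetherianRing A]
    [Algebra (MvPolynomial (Fin r) F) A] [FaithfulSMul (MvPolynomial (Fin r) F) A]
    [Algebra.IsIntegral (MvPolynomial (Fin r) F) A] (f : A) (hf0 : f ≠ 0) (hfu : ¬ IsUnit f) : 
    ringKrullDim (A ⧸ Ideal.span {f}) + 1 = r := by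
  apply le_antisymm
  · rw [← dim_of_integral F r (A := A)]
    exact ringKrullDim_quotient_succ_le_of_nonZeroDivisor (mem_nonZeroDivisors_of_ne_zero hf0)
  · obtain ⟨M, hM, hfM⟩ := exists_max_ideal_of_mem_nonunits hfu
    have h1 := le_height_maximal (F := F) (r := r) M hM
    refine le_trans ?_ (Ideal.height_le_ringKrullDim_quotient_add_one hfM)
    exact_mod_cast h1

end Dim


section NN
variable {F : Type} [Field F]

lemma prod_linear_coeff {S ι : Type} [CommRing S] (α β : ι → S) (m : ι → ℕ) (s : Finset ι) :
    (∏ i ∈ s, (Polynomial.C (α i) + Polynomial.C (β i) * Polynomial.X) ^ m i).natDegree ≤ ∑ i ∈ s, m i ∧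
    (∏ i ∈ s, (Polynomial.C (α i) + Polynomial.C (β i) * Polynomial.X) ^ m i).coeff (∑ i ∈ s, m i) = 
      ∏ i ∈ s, β i ^ m i := by
  induction s using Finset.induction_on with
  | empty => simp
  | insert i s hi ih =>
    rw [Finset.prod_insert hi, Finset.sum_insert hi, Finset.prod_insert hi]
    have h1 : (Polynomial.C (α i) + Polynomial.C (β i) * Polynomial.X).natDegree ≤ 1 := by
      compute_degree
    have h2 : ((Polynomial.C (α i) + Polynomial.C (β i) * Polynomial.X) ^ m i).natDegree ≤ m i := by
      simpa using Polynomial.natDegree_pow_le_of_le (m i) h1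
    refine ⟨Polynomial.natDegree_mul_le_of_le h2 ih.1, ?_⟩
    rw [Polynomial.coeff_mul_add_eq_of_natDegree_le h2 ih.1, ih.2]
    congr 1
    have := Polynomial.coeff_pow_of_natDegree_le (m := m i) h1
    rw [mul_one] at this
    rw [this]
    simp [Polynomial.coeff_C]

lemma core_integral {B ι : Type} [CommRing B] [Algebra F B] [Fintype ι] (S : Subalgebra F B)
    (t τ : B) (Z : ι → B) (a : ι → F) (ht : t ∈ S) (hZ : ∀ i, Z i - algebraMap F B (a i) * τ ∈ S)
    (g : MvPolynomial ι F) 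
    (hrel : ∑ m ∈ g.support, algebraMap F B (g.coeff m) * t ^ (g.totalDegree - m.degree) * ∏ i, Z i ^ m i = 0)
    (htop : MvPolynomial.eval a (homogeneousComponent g.totalDegree g) ≠ 0) : IsIntegral S τ := by
  set d := g.totalDegree with hd
  let t' : S := ⟨t, ht⟩
  let α : ι → S := fun i => ⟨_, hZ i⟩
  let Q : (ι →₀ ℕ) → Polynomial S := fun m => 
    ∏ i, (Polynomial.C (α i) + Polynomial.C (algebraMap F S (a i)) * Polynomial.X) ^ m i
  let P : Polynomial S := ∑ m ∈ g.support, Polynomial.C (algebraMap F S (g.coeff m) * t' ^ (d - m.degree)) * Q m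
  have hmd : ∀ m ∈ g.support, m.degree ≤ d := by
    intro m hm
    exact le_totalDegree hm
  have hdeg : ∀ m : ι →₀ ℕ, m.degree = ∑ i, m i := fun m => Finsupp.degree_eq_sum m
  have hQ : ∀ m : ι →₀ ℕ, (Q m).natDegree ≤ m.degree ∧ (Q m).coeff m.degree = algebraMap F S (∏ i, a i ^ m i) := by
    intro m
    have := prod_linear_coeff α (fun i => algebraMap F S (a i)) m Finset.univ
    rw [← hdeg] at this
    simpa [Q] using this
  have hPdeg : P.natDegree ≤ d := by
    apply Polynomial.natDegree_sum_le_of_forall_le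
    intro m hm
    exact (Polynomial.natDegree_C_mul_le _ _).trans ((hQ m).1.trans (hmd m hm))
  have hPco : P.coeff d = algebraMap F S (MvPolynomial.eval a (homogeneousComponent d g)) := by
    simp only [P, Polynomial.finsetSum_coeff, Polynomial.coeff_C_mul]
    rw [homogeneousComponent_apply, map_sum, map_sum, Finset.sum_filter]
    apply Finset.sum_congr rfl
    intro m hm
    split_ifs with h
    · rw [h, Nat.sub_self, pow_zero, mul_one, ← h, (hQ m).2, ← map_mul, eval_monomial, Finsupp.prod_fintype]
      intro i; simp
    · rw [Polynomial.coeff_eq_zero_of_natDegree_lt, mul_zero]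
      exact lt_of_le_of_lt (hQ m).1 (lt_of_le_of_ne (hmd m hm) h)
  set c := MvPolynomial.eval a (homogeneousComponent d g) with hc
  refine ⟨Polynomial.C (algebraMap F S c⁻¹) * P, ?_, ?_⟩
  · apply Polynomial.monic_of_natDegree_le_of_coeff_eq_one d
    · exact (Polynomial.natDegree_C_mul_le _ _).trans hPdeg
    · rw [Polynomial.coeff_C_mul, hPco, ← map_mul, inv_mul_cancel₀ htop, map_one]
  · rw [Polynomial.eval₂_mul]
    have : Polynomial.eval₂ (algebraMap S B) τ P = 0 := by
      rw [← hrel]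
      simp only [P, Q, Polynomial.eval₂_finsetSum, Polynomial.eval₂_mul, Polynomial.eval₂_C, 
        Polynomial.eval₂_finsetProd, Polynomial.eval₂_pow, Polynomial.eval₂_add, Polynomial.eval₂_X]
      apply Finset.sum_congr rfl
      intro m hm
      congr 1
      apply Finset.prod_congr rfl
      intro i _
      congr 1
      change (Z i - algebraMap F B (a i) * τ) + algebraMap F B (a i) * τ = Z i
      ring
    rw [this, mul_zero]

lemma integral_adjoin_trans {B : Type} [CommRing B] [Algebra F B] (S : Subalgebra F B) (T : Set B)
    (hT : ∀ b ∈ T, IsIntegral S b) (b : B) (hb : IsIntegral (Algebra.adjoin F T) b) : IsIntegral S b := by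
  have hle : Algebra.adjoin F T ≤ (integralClosure S B).restrictScalars F := by
    rw [Algebra.adjoin_le_iff]
    exact hT
  let φ : Algebra.adjoin F T →+* integralClosure S B := 
    (Subalgebra.inclusion hle).toRingHom
  let _ := φ.toAlgebra
  have : IsScalarTower (Algebra.adjoin F T) (integralClosure S B) B := IsScalarTower.of_algebraMap_eq (fun _ => rfl)
  exact isIntegral_trans (A := integralClosure S B) b hb.tower_top

variable [Infinite F] {A : Type} [CommRing A] [Algebra F A] [Nontrivial A] {n : ℕ}

/-- Generators of the cone over the span of linear forms. -/
def coneGen (x : Fin n → A) {k : ℕ} (y : Fin k → Fin n → F) : Set (Polynomial A) :=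
  insert Polynomial.X (Set.range fun i => Polynomial.X * Polynomial.C (Fintype.linearCombination F x (y i)))

lemma NN_step (x : Fin n → A) (k : ℕ) (y : Fin (k + 1) → Fin n → F) 
    (hdep : ¬ AlgebraicIndependent F (fun i => Fintype.linearCombination F x (y i))) :
    ∃ y' : Fin k → Fin n → F, ∀ i, IsIntegral (Algebra.adjoin F (coneGen x y')) 
      (Polynomial.X * Polynomial.C (Fintype.linearCombination F x (y i))) := by
  set z := fun i => Fintype.linearCombination F x (y i) with hz
  rw [algebraicIndependent_iff] at hdep
  push Not at hdep
  obtain ⟨g, hg0, hgne⟩ := hdep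
  have hd : g.totalDegree ≠ 0 := by
    intro h
    rw [totalDegree_eq_zero_iff_eq_C] at h
    rw [h, aeval_C] at hg0
    have := (FaithfulSMul.algebraMap_injective F A) (hg0.trans (map_zero _).symm)
    rw [this, C_0] at h
    exact hgne h
  have htop : homogeneousComponent g.totalDegree g ≠ 0 := by
    intro h
    obtain ⟨m, hm, hmd'⟩ := Finset.exists_mem_eq_sup g.support (support_nonempty.2 hgne) (fun s => s.sum fun _ e => e)
    have hmd : m.degree = g.totalDegree := hmd'.symm
    have := coeff_homogeneousComponent g.totalDegree g m
    rw [h, if_pos hmd, coeff_zero] at this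
    exact (mem_support_iff.1 hm) this.symm
  obtain ⟨a, ha⟩ : ∃ a, MvPolynomial.eval a (homogeneousComponent g.totalDegree g) ≠ 0 := by
    by_contra hcon
    push Not at hcon
    exact htop (MvPolynomial.funext fun a => by rw [hcon a, map_zero])
  obtain ⟨i0, hi0⟩ : ∃ i, a i ≠ 0 := by
    by_contra hcon
    push Not at hcon
    have : a = 0 := _root_.funext hcon
    rw [this] at ha
    apply ha
    have := (homogeneousComponent_isHomogeneous g.totalDegree g).coeff_eq_zero (d := 0) (by simpa using hd.symm)
    rw [eval_zero]
    exact this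
  let y' : Fin k → Fin n → F := fun l => y (i0.succAbove l) - (a (i0.succAbove l) * (a i0)⁻¹) • y i0
  let τ : Polynomial A := Polynomial.X * Polynomial.C ((a i0)⁻¹ • z i0)
  have halg : ∀ (c : F) , algebraMap F (Polynomial A) c = Polynomial.C (algebraMap F A c) := fun c => rfl
  have hmem : ∀ i, Polynomial.X * Polynomial.C (z i) - algebraMap F (Polynomial A) (a i) * τ ∈ 
      Algebra.adjoin F (coneGen x y') := by
    intro i
    have h1 : Polynomial.X * Polynomial.C (z i) - algebraMap F (Polynomial A) (a i) * τ = 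
      Polynomial.X * Polynomial.C (z i - (a i * (a i0)⁻¹) • z i0) := by
      simp only [τ, halg, Algebra.smul_def, map_mul, map_sub]
      ring
    rw [h1]
    rcases Fin.eq_self_or_eq_succAbove i0 i with h | ⟨l, h⟩
    · rw [h, mul_inv_cancel₀ hi0, one_smul, sub_self, map_zero, mul_zero]
      exact zero_mem _
    · apply Algebra.subset_adjoin
      right
      refine ⟨l, ?_⟩
      simp [y', h, hz]
  have hτ : IsIntegral (Algebra.adjoin F (coneGen x y')) τ := by
    refine core_integral _ Polynomial.X τ (fun i => Polynomial.X * Polynomial.C (z i)) a 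
      (Algebra.subset_adjoin (Set.mem_insert _ _)) hmem g ?_ ha
    have : ∑ m ∈ g.support, algebraMap F (Polynomial A) (g.coeff m) * Polynomial.X ^ (g.totalDegree - m.degree) * 
        ∏ i, (Polynomial.X * Polynomial.C (z i)) ^ m i = 
        Polynomial.X ^ g.totalDegree * Polynomial.C (aeval z g) := by
      rw [aeval_def, eval₂_eq', map_sum, Finset.mul_sum]
      apply Finset.sum_congr rfl
      intro m hm
      have hmd : m.degree ≤ g.totalDegree := le_totalDegree hm
      simp only [mul_pow, Finset.prod_mul_distrib, Finset.prod_pow_eq_pow_sum, ← Finsupp.degree_eq_sum, map_mul, 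
        map_prod, map_pow, halg]
      obtain ⟨e, he⟩ := Nat.exists_eq_add_of_le hmd
      rw [he, Nat.add_sub_cancel_left, pow_add]
      ring
    rw [this, hg0, map_zero, mul_zero]
  refine ⟨y', fun i => ?_⟩
  have h1 : Polynomial.X * Polynomial.C (z i) = (Polynomial.X * Polynomial.C (z i) - algebraMap F (Polynomial A) (a i) * τ) 
    + algebraMap F (Polynomial A) (a i) * τ := by ring
  change IsIntegral _ (Polynomial.X * Polynomial.C (z i))
  rw [h1]
  apply IsIntegral.add
  · exact isIntegral_algebraMap (x := (⟨_, hmem i⟩ : Algebra.adjoin F (coneGen x y')))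
  · apply IsIntegral.mul _ hτ
    exact isIntegral_algebraMap (x := algebraMap F (Algebra.adjoin F (coneGen x y')) (a i))

/-- Linear, projective Noether normalization. -/
lemma NN (x : Fin n → A) : ∃ (r : ℕ) (y : Fin r → Fin n → F), 
    AlgebraicIndependent F (fun i => Fintype.linearCombination F x (y i)) ∧
    ∀ j, IsIntegral (Algebra.adjoin F (coneGen x y)) (Polynomial.X * Polynomial.C (x j)) := by
  have hex : ∃ k : ℕ, ∃ y : Fin k → Fin n → F, 
      ∀ j, IsIntegral (Algebra.adjoin F (coneGen x y)) (Polynomial.X * Polynomial.C (x j)) := by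
    refine ⟨n, fun i => Pi.single i 1, fun j => ?_⟩
    have : Polynomial.X * Polynomial.C (x j) ∈ Algebra.adjoin F (coneGen x (fun i => Pi.single i (1 : F))) := by
      apply Algebra.subset_adjoin
      right
      exact ⟨j, by simp⟩
    exact isIntegral_algebraMap (x := (⟨_, this⟩ : Algebra.adjoin F (coneGen x (fun i => Pi.single i (1 : F)))))
  obtain ⟨y, hy⟩ := Nat.find_spec hex
  refine ⟨Nat.find hex, y, ?_, hy⟩
  by_contra hdep
  have hmin := fun k => Nat.find_min hex (m := k)
  generalize Nat.find hex = k at *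
  cases k with
  | zero =>
    apply hdep
    rw [algebraicIndependent_empty_type_iff]
    exact FaithfulSMul.algebraMap_injective F A
  | succ k =>
    obtain ⟨y', hy'⟩ := NN_step x k y hdep
    apply hmin k (Nat.lt_succ_self k)
    refine ⟨y', fun j => ?_⟩
    apply integral_adjoin_trans _ (coneGen x y) _ _ (hy j)
    rintro b (rfl | ⟨i, rfl⟩)
    · exact isIntegral_algebraMap (x := (⟨_, Algebra.subset_adjoin (Set.mem_insert _ _)⟩ : Algebra.adjoin F (coneGen x y')))
    · exact hy' i

end NN


section Ext

lemma lift_hom {D E K : Type} [CommRing D] [IsDomain D] [CommRing E] [IsDomain E] [Field K] [IsAlgClosed K]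
    [Algebra D E] [Algebra D K] (h1 : Function.Injective (algebraMap D E))
    (h2 : Function.Injective (algebraMap D K)) (h3 : Algebra.IsIntegral D E) : Nonempty (E →ₐ[D] K) := by
  have := (faithfulSMul_iff_algebraMap_injective D E).2 h1
  have := (faithfulSMul_iff_algebraMap_injective D K).2 h2
  exact ⟨IsAlgClosed.lift⟩

lemma ext_hom {S B K : Type} [CommRing S] [CommRing B] [Field K] [IsAlgClosed K] [Algebra S B]
    [FaithfulSMul S B] [Algebra.IsIntegral S B] (ψ : S →+* K) :
    ∃ φ : B →+* K, φ.comp (algebraMap S B) = ψ := by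
  have hp : (RingHom.ker ψ).IsPrime := RingHom.ker_isPrime ψ
  obtain ⟨Q, -, hQ, hQp⟩ := Ideal.exists_ideal_over_prime_of_isIntegral (RingHom.ker ψ) (⊥ : Ideal B) (by
    intro s hs
    rw [Ideal.mem_comap, Ideal.mem_bot, map_eq_zero_iff _ (FaithfulSMul.algebraMap_injective S B)] at hs
    rw [hs]; exact zero_mem _)
  have hlo : Q.LiesOver (RingHom.ker ψ) := ⟨hQp.symm⟩
  let _ : Algebra (S ⧸ RingHom.ker ψ) K := (RingHom.kerLift ψ).toAlgebra
  have h2 : Function.Injective (algebraMap (S ⧸ RingHom.ker ψ) (B ⧸ Q)) := by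
    rw [injective_iff_map_eq_zero]
    intro s hs
    obtain ⟨s, rfl⟩ := Ideal.Quotient.mk_surjective s
    rw [Ideal.Quotient.algebraMap_mk_of_liesOver, Ideal.Quotient.eq_zero_iff_mem] at hs
    rw [Ideal.Quotient.eq_zero_iff_mem, ← hQp]
    exact hs
  have h3 : Algebra.IsIntegral (S ⧸ RingHom.ker ψ) (B ⧸ Q) := inferInstance
  obtain ⟨f⟩ := lift_hom (K := K) h2 (RingHom.kerLift_injective ψ) h3
  refine ⟨f.toRingHom.comp (Ideal.Quotient.mk Q), ?_⟩
  ext s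
  have := f.commutes (Ideal.Quotient.mk _ s)
  rw [Ideal.Quotient.algebraMap_mk_of_liesOver] at this
  exact this

variable {R B : Type} [CommRing R] [IsDomain R] [IsIntegrallyClosed R] [CommRing B] [IsDomain B]
  [Algebra R B] [FaithfulSMul R B] [Algebra.IsIntegral R B]

lemma root_ext {K : Type} [Field K] [IsAlgClosed K] (φ₀ : R →+* K) (b : B) (c : K)
    (hc : Polynomial.eval₂ φ₀ c (minpoly R b) = 0) :
    ∃ φ : B →+* K, φ.comp (algebraMap R B) = φ₀ ∧ φ b = c := by
  have hb : IsIntegral R b := Algebra.IsIntegral.isIntegral b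
  have htf : Module.IsTorsionFree R B := inferInstance
  let e := minpoly.equivAdjoin hb
  let ψ : Algebra.adjoin R {b} →+* K := (AdjoinRoot.lift φ₀ c hc).comp (e.symm : Algebra.adjoin R {b} →+* _)
  have hint : Algebra.IsIntegral (Algebra.adjoin R {b}) B := Algebra.IsIntegral.tower_top (R := R)
  obtain ⟨φ, hφ⟩ := ext_hom (B := B) ψ
  refine ⟨φ, ?_, ?_⟩
  · ext s
    have := RingHom.congr_fun hφ (algebraMap R _ s)
    have h2 : e.symm (algebraMap R _ s) = algebraMap R _ s := e.symm.commutes s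
    simp only [RingHom.comp_apply, ψ, RingHom.coe_coe, h2] at this
    rw [← IsScalarTower.algebraMap_apply] at this
    rw [RingHom.comp_apply, this]
    exact AdjoinRoot.lift_of hc
  · have := RingHom.congr_fun hφ ⟨b, Algebra.subset_adjoin rfl⟩
    have h2 : e.symm ⟨b, Algebra.subset_adjoin rfl⟩ = AdjoinRoot.root _ := by
      rw [AlgEquiv.symm_apply_eq]
      apply Subtype.ext
      simp [e, AdjoinRoot.Minpoly.toAdjoin]
    simp only [RingHom.comp_apply, ψ, RingHom.coe_coe, h2] at this
    rw [AdjoinRoot.lift_root] at this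
    exact this

lemma exists_sep (p : ℕ) [ExpChar R p] (b : B) : 
    ∃ (m : ℕ) (h u v : Polynomial R) (d : R), h.Monic ∧ minpoly R b = Polynomial.expand R (p ^ m) h ∧ d ≠ 0 ∧
      u * h + v * Polynomial.derivative h = Polynomial.C d := by
  have hb : IsIntegral R b := Algebra.IsIntegral.isIntegral b
  let K := FractionRing R
  let L := FractionRing B
  have hKinj : Function.Injective (algebraMap R K) := IsFractionRing.injective R K
  have : ExpChar K p := expChar_of_injective_algebraMap hKinj p
  have : FaithfulSMul R L := by
    rw [faithfulSMul_iff_algebraMap_injective, IsScalarTower.algebraMap_eq R B L]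
    exact (IsFractionRing.injective B L).comp (FaithfulSMul.algebraMap_injective R B)
  let _ : Algebra K L := FractionRing.liftAlgebra R L
  have : IsScalarTower R K L := FractionRing.isScalarTower_liftAlgebra R L
  have hmin := minpoly.isIntegrallyClosed_eq_field_fractions K L hb
  have hirr : Irreducible (minpoly K (algebraMap B L b)) := by
    apply minpoly.irreducible
    exact (hb.map (IsScalarTower.toAlgHom R B L)).tower_top
  obtain ⟨g, hgs, m, hm⟩ := hirr.hasSeparableContraction p
  have hq : p ^ m ≠ 0 := pow_ne_zero _ (expChar_ne_zero R p)
  set G := minpoly R b with hG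
  let h := Polynomial.contract (p ^ m) G
  have hmap : h.map (algebraMap R K) = g := by
    rw [Polynomial.map_contract hq, ← hmin, ← hm, Polynomial.contract_expand _ hq]
  have hGh : G = Polynomial.expand R (p ^ m) h := by
    apply Polynomial.map_injective _ hKinj
    rw [Polynomial.map_expand, hmap, hm, hmin]
  have hmon : h.Monic := by
    have := minpoly.monic hb
    rw [← hG, hGh] at this
    exact (Polynomial.monic_expand_iff (Nat.pos_of_ne_zero hq)).1 this
  obtain ⟨a, b', hab⟩ := hgs
  obtain ⟨d1, hm1, hd1⟩ := IsLocalization.integerNormalization_spec (nonZeroDivisors R) a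
  obtain ⟨d2, hm2, hd2⟩ := IsLocalization.integerNormalization_spec (nonZeroDivisors R) b'
  refine ⟨m, h, Polynomial.C d2 * IsLocalization.integerNormalization (nonZeroDivisors R) a, 
    Polynomial.C d1 * IsLocalization.integerNormalization (nonZeroDivisors R) b', d1 * d2, hmon, hGh,
    mul_ne_zero (nonZeroDivisors.ne_zero hm1) (nonZeroDivisors.ne_zero hm2), ?_⟩
  apply Polynomial.map_injective _ hKinj
  simp only [Polynomial.map_add, Polynomial.map_mul, Polynomial.map_C, ← Polynomial.derivative_map, hmap]
  rw [hd1, hd2]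
  have e : ∀ (d : R) (q : Polynomial K), d • q = Polynomial.C (algebraMap R K d) * q := fun d q => by
    rw [← algebraMap_smul K d q, Polynomial.smul_eq_C_mul]
  rw [e, e, map_mul, Polynomial.C_mul]
  linear_combination Polynomial.C (algebraMap R K d1) * Polynomial.C (algebraMap R K d2) * hab
end Ext


set_option linter.unusedSectionVars false

section ConeSec

/-- An integral extension `B` of a polynomial ring, realized inside `A[t]`, containing the elements `t x_j`. -/
structure Cone {F : Type} [Field F] {n r : ℕ} {A B : Type} [CommRing A] [Algebra F A] [CommRing B] 
    [Algebra (MvPolynomial (Option (Fin r)) F) B] (x : Fin n → A) (y : Fin r → Fin n → F) 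
    (ι : B →+* Polynomial A) (τ : Fin n → B) : Prop where
  inj : Function.Injective ι
  hC : ∀ c, ι (algebraMap (MvPolynomial (Option (Fin r)) F) B (C c)) = Polynomial.C (algebraMap F A c)
  ht : ι (algebraMap (MvPolynomial (Option (Fin r)) F) B (X none)) = Polynomial.X
  hτ : ∀ j, ι (τ j) = Polynomial.X * Polynomial.C (x j)
  hy : ∀ i, algebraMap (MvPolynomial (Option (Fin r)) F) B (X (some i)) = 
    ∑ j, algebraMap (MvPolynomial (Option (Fin r)) F) B (C (y i j)) * τ j

/-- The point `(t, Y)` of the parameter space. -/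
def opt {F : Type} {r : ℕ} (t : F) (Y : Fin r → F) : Option (Fin r) → F := fun o => o.elim t Y

variable {F : Type} [Field F] {n r : ℕ} {A B : Type} [CommRing A] [Algebra F A] [CommRing B] 
    [Algebra (MvPolynomial (Option (Fin r)) F) B] {x : Fin n → A} {y : Fin r → Fin n → F}
    {ι : B →+* Polynomial A} {τ : Fin n → B} 

lemma Cone.point (hc : Cone x y ι τ) (t₀ : F) (Y : Fin r → F) (ht₀ : t₀ ≠ 0) (φ : B →+* F)
    (hφ : φ.comp (algebraMap (MvPolynomial (Option (Fin r)) F) B) = eval (opt t₀ Y)) 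
    (f : MvPolynomial (Fin n) F) (hf : aeval x f = 0) : eval (fun j => φ (τ j) / t₀) f = 0 := by
  have hφ' : ∀ g, φ (algebraMap (MvPolynomial (Option (Fin r)) F) B g) = eval (opt t₀ Y) g := 
    fun g => RingHom.congr_fun hφ g
  have key : ∀ f : MvPolynomial (Fin n) F, ∃ (k : ℕ) (b : B), 
      ι b = Polynomial.X ^ k * Polynomial.C (aeval x f) ∧ φ b = t₀ ^ k * eval (fun j => φ (τ j) / t₀) f := by
    intro f
    induction f using MvPolynomial.induction_on with
    | C c => exact ⟨0, algebraMap (MvPolynomial (Option (Fin r)) F) B (C c), by simp [hc.hC], by simp [hφ']⟩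
    | add f g hf hg =>
      obtain ⟨k, b, h1, h2⟩ := hf
      obtain ⟨l, b', h3, h4⟩ := hg
      refine ⟨k + l, algebraMap (MvPolynomial (Option (Fin r)) F) B (X none) ^ l * b + 
        algebraMap (MvPolynomial (Option (Fin r)) F) B (X none) ^ k * b', ?_, ?_⟩
      · simp only [map_add, map_mul, map_pow, hc.ht, h1, h3]
        ring
      · have : φ (algebraMap (MvPolynomial (Option (Fin r)) F) B (X none)) = t₀ := by rw [hφ']; simp [opt]
        simp only [map_add, map_mul, map_pow, this, h2, h4]
        ring
    | mul_X f j hf =>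
      obtain ⟨k, b, h1, h2⟩ := hf
      refine ⟨k + 1, b * τ j, ?_, ?_⟩
      · simp only [map_mul, hc.hτ, h1, aeval_X]
        ring
      · simp only [map_mul, h2, eval_X]
        field_simp
        ring
  obtain ⟨k, b, h1, h2⟩ := key f
  rw [hf, map_zero, mul_zero, map_eq_zero_iff _ hc.inj] at h1
  rw [h1, map_zero] at h2
  exact (mul_eq_zero.1 h2.symm).resolve_left (pow_ne_zero _ ht₀)

lemma Cone.point_lin (hc : Cone x y ι τ) (t₀ : F) (Y : Fin r → F) (φ : B →+* F)
    (hφ : φ.comp (algebraMap (MvPolynomial (Option (Fin r)) F) B) = eval (opt t₀ Y)) (i : Fin r) :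
    ∑ j, y i j * φ (τ j) = Y i := by
  have hφ' : ∀ g, φ (algebraMap (MvPolynomial (Option (Fin r)) F) B g) = eval (opt t₀ Y) g := 
    fun g => RingHom.congr_fun hφ g
  have := congrArg φ (hc.hy i)
  rw [hφ', map_sum] at this
  simp only [map_mul, hφ', eval_C, eval_X] at this
  exact this.symm

/-- A point of the variety gives a point of the cone at `t = 1`. -/
lemma Cone.of_point (hc : Cone x y ι τ) (σ : A →ₐ[F] F) (t₀ : F) : ∃ φ : B →+* F, 
    φ.comp (algebraMap (MvPolynomial (Option (Fin r)) F) B) = eval (opt t₀ (fun i => t₀ * ∑ j, y i j * σ (x j))) ∧ 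
    ∀ j, φ (τ j) = t₀ * σ (x j) := by
  let φ : B →+* F := ((σ : A →+* F).comp (Polynomial.evalRingHom (algebraMap F A t₀))).comp ι
  have hτ : ∀ j, φ (τ j) = t₀ * σ (x j) := by
    intro j
    simp [φ, hc.hτ]
    ring
  have hC : ∀ c : F, φ (algebraMap (MvPolynomial (Option (Fin r)) F) B (C c)) = c := by
    intro c
    simp [φ, hc.hC]
  refine ⟨φ, ?_, hτ⟩
  apply MvPolynomial.ringHom_ext
  · intro c
    rw [RingHom.comp_apply, hC]; simp
  · intro o
    cases o with
    | none => simp [φ, hc.ht, opt]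
    | some i =>
      rw [RingHom.comp_apply, hc.hy, map_sum, eval_X]
      simp only [map_mul, hC, hτ, opt, Option.elim]
      rw [Finset.mul_sum]
      apply Finset.sum_congr rfl
      intros; ring

variable [IsDomain B] [FaithfulSMul (MvPolynomial (Option (Fin r)) F) B] 
  [Algebra.IsIntegral (MvPolynomial (Option (Fin r)) F) B]

/-- The set of values of extensions of a given evaluation. -/
def coneFib (τ : Fin n → B) (P : Option (Fin r) → F) : Set (Fin n → F) := 
  {q | ∃ φ : B →+* F, φ.comp (algebraMap (MvPolynomial (Option (Fin r)) F) B) = eval P ∧ ∀ j, q j = φ (τ j)}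

lemma eval_minpoly {R K B : Type} [CommRing R] [CommRing K] [CommRing B] [Algebra R B] (φ₀ : R →+* K) 
    (φ : B →+* K) (hφ : φ.comp (algebraMap R B) = φ₀) (b : B) : Polynomial.eval₂ φ₀ (φ b) (minpoly R b) = 0 := by
  have := congrArg φ (minpoly.aeval R b)
  rw [Polynomial.aeval_def, Polynomial.hom_eval₂, hφ, map_zero] at this
  exact this

lemma coneFib_finite (τ : Fin n → B) (P : Option (Fin r) → F) : (coneFib τ P).Finite := by
  let S : Fin n → Finset F := fun j => ((minpoly (MvPolynomial (Option (Fin r)) F) (τ j)).map (eval P)).roots.toFinset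
  apply Set.Finite.subset (Set.Finite.pi' (fun j => (S j).finite_toSet))
  rintro q ⟨φ, hφ, hq⟩ j
  have hm : (minpoly (MvPolynomial (Option (Fin r)) F) (τ j)).Monic := 
    minpoly.monic (Algebra.IsIntegral.isIntegral _)
  simp only [S, Finset.mem_coe, Multiset.mem_toFinset]
  rw [Polynomial.mem_roots (hm.map _).ne_zero, Polynomial.IsRoot, Polynomial.eval_map, hq j]
  exact eval_minpoly _ φ hφ _

lemma exists_separating [Infinite F] (Q : Set (Fin n → F)) (hQ : Q.Finite) : 
    ∃ l : Fin n → F, Set.InjOn (fun q : Fin n → F => ∑ j, l j * q j) Q := by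
  let S := hQ.toFinset.offDiag
  let g : MvPolynomial (Fin n) F := ∏ pq ∈ S, ∑ j, C (pq.1 j - pq.2 j) * X j
  have hg : g ≠ 0 := by
    rw [Finset.prod_ne_zero_iff]
    rintro ⟨p, q⟩ hpq h0
    have hne : p ≠ q := (Finset.mem_offDiag.1 hpq).2.2
    apply hne
    ext j
    have := congrArg (eval (Pi.single j (1:F))) h0
    simp [map_sum, Pi.single_apply] at this
    exact sub_eq_zero.1 this
  obtain ⟨l, hl⟩ : ∃ l, eval l g ≠ 0 := by
    by_contra hcon
    push Not at hcon
    exact hg (MvPolynomial.funext fun a => by rw [hcon a, map_zero])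
  refine ⟨l, fun p hp q hq hpq => ?_⟩
  by_contra hne
  rw [map_prod, Finset.prod_ne_zero_iff] at hl
  apply hl (p, q) (Finset.mem_offDiag.2 ⟨hQ.mem_toFinset.2 hp, hQ.mem_toFinset.2 hq, hne⟩)
  simp only [map_sum, map_mul, eval_C, eval_X]
  have : ∑ j, (p j - q j) * l j = ∑ j, l j * p j - ∑ j, l j * q j := by
    rw [← Finset.sum_sub_distrib]; apply Finset.sum_congr rfl; intros; ring
  rw [this]; exact sub_eq_zero.2 hpq

variable [IsAlgClosed F]

/-- Some linear section is at least as big as the fiber of the cone at infinity. -/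
lemma Cone.count (hc : Cone x y ι τ) (W : Set (Fin n → F)) 
    (hW : ∀ w, (∀ f : MvPolynomial (Fin n) F, aeval x f = 0 → eval w f = 0) → w ∈ W)
    (hfin : ∀ c : Fin r → F, (W ∩ {w | ∀ i, ∑ j, y i j * w j = c i}).Finite) (P : Option (Fin r) → F) : 
    ∃ c : Fin r → F, (coneFib τ P).ncard ≤ (W ∩ {w | ∀ i, ∑ j, y i j * w j = c i}).ncard := by
  have : Infinite F := IsAlgClosed.instInfinite
  have hQ := coneFib_finite τ P
  obtain ⟨l, hl⟩ := exists_separating _ hQ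
  let b : B := ∑ j, algebraMap (MvPolynomial (Option (Fin r)) F) B (C (l j)) * τ j
  obtain ⟨p, hp⟩ := ExpChar.exists F
  have : ExpChar (MvPolynomial (Option (Fin r)) F) p := 
    expChar_of_injective_ringHom (R := F) (C_injective (Option (Fin r)) F) p
  obtain ⟨m, h, u, v, d, hmon, hGh, hd, huv⟩ := exists_sep (R := MvPolynomial (Option (Fin r)) F) p b
  have hφb : ∀ (P : Option (Fin r) → F) (φ : B →+* F)
      (_ : φ.comp (algebraMap (MvPolynomial (Option (Fin r)) F) B) = eval P), φ b = ∑ j, l j * φ (τ j) := by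
    intro P φ hφ
    have hφ' : ∀ g, φ (algebraMap (MvPolynomial (Option (Fin r)) F) B g) = eval P g := 
      fun g => RingHom.congr_fun hφ g
    simp [b, hφ']
  have hev : ∀ (P : Option (Fin r) → F) (c : F), 
    Polynomial.eval₂ (eval P) c (minpoly (MvPolynomial (Option (Fin r)) F) b) = (h.map (eval P)).eval (c ^ (p ^ m)) := by
    intro P c
    rw [hGh, Polynomial.expand_eq_comp_X_pow, Polynomial.eval₂_comp]
    simp [Polynomial.eval_map]
  -- upper bound
  have hup : (coneFib τ P).ncard ≤ h.natDegree := by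
    have h1 : (coneFib τ P).ncard ≤ ((h.map (eval P)).roots.toFinset : Set F).ncard := by
      apply Set.ncard_le_ncard_of_injOn (fun q => (∑ j, l j * q j) ^ (p ^ m))
      · rintro q ⟨φ, hφ, hq⟩
        simp only [Finset.mem_coe, Multiset.mem_toFinset]
        rw [Polynomial.mem_roots (hmon.map _).ne_zero, Polynomial.IsRoot]
        have h2 := eval_minpoly _ φ hφ b
        rw [hev, hφb P φ hφ] at h2
        simpa only [hq] using h2
      · intro q hq q' hq' he
        apply hl hq hq'
        have := iterateFrobenius_inj F p m
        exact this he
    rw [Set.ncard_coe_finset] at h1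
    refine h1.trans ((Multiset.toFinset_card_le _).trans ((Polynomial.card_roots' _).trans ?_))
    exact Polynomial.natDegree_map_le
  obtain ⟨P', hP'⟩ : ∃ P', eval P' (d * X none) ≠ 0 := by
    by_contra hcon
    push Not at hcon
    exact mul_ne_zero hd (X_ne_zero none) (MvPolynomial.funext fun a => by rw [hcon a, map_zero])
  rw [map_mul, eval_X] at hP'
  have hd' : eval P' d ≠ 0 := left_ne_zero_of_mul hP'
  have ht₀ : P' none ≠ 0 := right_ne_zero_of_mul hP'
  set t₀ := P' none with ht₀def
  have hPopt : P' = opt t₀ (fun i => P' (some i)) := by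
    ext o; cases o <;> rfl
  have hsep : (h.map (eval P')).Separable := by
    have := congrArg (Polynomial.map (eval P')) huv
    simp only [Polynomial.map_add, Polynomial.map_mul, Polynomial.map_C, ← Polynomial.derivative_map] at this
    refine ⟨Polynomial.C (eval P' d)⁻¹ * u.map (eval P'), Polynomial.C (eval P' d)⁻¹ * v.map (eval P'), ?_⟩
    rw [mul_assoc, mul_assoc, ← mul_add, this, ← Polynomial.C_mul, inv_mul_cancel₀ hd', Polynomial.C_1]
  have hcard : (h.map (eval P')).roots.toFinset.card = h.natDegree := by
    rw [Multiset.toFinset_card_of_nodup (Polynomial.nodup_roots hsep), ← hmon.natDegree_map (eval P')]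
    exact (IsAlgClosed.splits _).natDegree_eq_card_roots.symm
  let c : Fin r → F := fun i => P' (some i) / t₀
  refine ⟨c, hup.trans ?_⟩
  rw [← hcard]
  have hsub : (((h.map (eval P')).roots.toFinset : Finset F) : Set F) ⊆ 
      (fun w : Fin n → F => (t₀ * ∑ j, l j * w j) ^ (p ^ m)) '' (W ∩ {w | ∀ i, ∑ j, y i j * w j = c i}) := by
    intro z hz
    simp only [Finset.mem_coe, Multiset.mem_toFinset] at hz
    rw [Polynomial.mem_roots (hmon.map _).ne_zero, Polynomial.IsRoot] at hz
    have hq : p ^ m ≠ 0 := pow_ne_zero _ (expChar_ne_zero F p)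
    obtain ⟨s, hs⟩ := IsAlgClosed.exists_pow_nat_eq z (Nat.pos_of_ne_zero hq)
    obtain ⟨φ, hφ, hφs⟩ := root_ext (eval P') b s (by rw [hev, hs, hz])
    refine ⟨fun j => φ (τ j) / t₀, ⟨?_, ?_⟩, ?_⟩
    · apply hW
      intro f hf
      exact hc.point t₀ _ ht₀ φ (by rw [hφ, ← hPopt]) f hf
    · intro i
      have := hc.point_lin t₀ (fun i => P' (some i)) φ (by rw [hφ, ← hPopt]) i
      simp only [c, ← this, Finset.sum_div, mul_div_assoc]
    · have h1 := hφb P' φ hφ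
      rw [hφs] at h1
      rw [← hs, h1]
      change (t₀ * ∑ j, l j * (φ (τ j) / t₀)) ^ p ^ m = _
      rw [Finset.mul_sum]
      congr 1
      apply Finset.sum_congr rfl
      intro j _
      field_simp
  have := Set.ncard_le_ncard hsub ((hfin c).image _)
  rw [Set.ncard_coe_finset] at this
  exact this.trans (Set.ncard_image_le (hfin c))

/-- Bad parameters come from the fiber at infinity. -/
lemma Cone.bad (hc : Cone x y ι τ) [Nontrivial A] (W : Set (Fin n → F)) 
    (hW : ∀ w, (∀ f : MvPolynomial (Fin n) F, aeval x f = 0 → eval w f = 0) → w ∈ W) (Y₀ : Fin r → F) (g : Fin n → F)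
    (hbad : 1 + ∑ j, g j • x j = 0 ∨ ∀ w ∈ W, 1 + ∑ j, g j * w j ≠ 0) :
    ∃ q ∈ coneFib τ (opt 0 Y₀), ∑ j, g j * q j = 0 := by
  have : Infinite F := IsAlgClosed.instInfinite
  let b : B := algebraMap (MvPolynomial (Option (Fin r)) F) B (X none) + 
    ∑ j, algebraMap (MvPolynomial (Option (Fin r)) F) B (C (g j)) * τ j
  have hιb : ι b = Polynomial.X * Polynomial.C (1 + ∑ j, g j • x j) := by
    simp only [b, map_add, map_sum, map_mul, hc.ht, hc.hC, hc.hτ, Algebra.smul_def, map_one, mul_add, mul_one, 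
      Finset.mul_sum]
    congr 1
    apply Finset.sum_congr rfl
    intros; ring
  have hφb : ∀ (t₀ : F) (Y) (φ : B →+* F)
      (_ : φ.comp (algebraMap (MvPolynomial (Option (Fin r)) F) B) = eval (opt t₀ Y)), 
      φ b = t₀ + ∑ j, g j * φ (τ j) := by
    intro t₀ Y φ hφ
    have hφ' : ∀ f, φ (algebraMap (MvPolynomial (Option (Fin r)) F) B f) = eval (opt t₀ Y) f := 
      fun g => RingHom.congr_fun hφ g
    simp [b, hφ', opt]
  suffices hs : ∃ φ : B →+* F, φ.comp (algebraMap (MvPolynomial (Option (Fin r)) F) B) = eval (opt 0 Y₀) ∧ φ b = 0 by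
    obtain ⟨φ, hφ, h0⟩ := hs
    refine ⟨fun j => φ (τ j), ⟨φ, hφ, fun _ => rfl⟩, ?_⟩
    rw [hφb _ _ _ hφ, zero_add] at h0
    exact h0
  rcases hbad with h0 | hempty
  · obtain ⟨φ, hφ⟩ := ext_hom (B := B) (eval (opt 0 Y₀) : MvPolynomial (Option (Fin r)) F →+* F)
    refine ⟨φ, hφ, ?_⟩
    rw [h0, map_zero, mul_zero, map_eq_zero_iff _ hc.inj] at hιb
    rw [hιb, map_zero]
  set G := minpoly (MvPolynomial (Option (Fin r)) F) b with hG
  set g0 := G.coeff 0 with hg0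
  have hroot0 : ∀ P : Option (Fin r) → F, eval P g0 = 0 → Polynomial.eval₂ (eval P) 0 G = 0 := by
    intro P hP
    rw [Polynomial.eval₂_at_zero]; exact hP
  have hne : ∀ (t : F) Y, t ≠ 0 → eval (opt t Y) g0 ≠ 0 := by
    intro t Y ht h0
    obtain ⟨φ, hφ, hφ0⟩ := root_ext (eval (opt t Y)) b 0 (hroot0 _ h0)
    rw [hφb _ _ _ hφ] at hφ0
    apply hempty (fun j => φ (τ j) / t) (hW _ fun f hf => hc.point t Y ht φ hφ f hf)
    have : 1 + ∑ j, g j * (φ (τ j) / t) = (t + ∑ j, g j * φ (τ j)) / t := by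
      rw [add_div, div_self ht, Finset.sum_div]
      simp only [mul_div_assoc]
    rw [this, hφ0, zero_div]
  have h00 : eval (opt 0 (0 : Fin r → F)) g0 = 0 := by
    let ρ : B →+* A := (Polynomial.evalRingHom 0).comp ι
    have hρ : ρ.comp (algebraMap (MvPolynomial (Option (Fin r)) F) B) = (algebraMap F A).comp (eval (opt 0 0)) := by
      apply MvPolynomial.ringHom_ext
      · intro c; simp [ρ, hc.hC]
      · intro o
        cases o with
        | none => simp [ρ, hc.ht, opt]
        | some i => 
          rw [RingHom.comp_apply, hc.hy]
          simp [ρ, hc.hτ, opt]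
    have h1 := congrArg ρ (minpoly.aeval (MvPolynomial (Option (Fin r)) F) b)
    rw [Polynomial.aeval_def, Polynomial.hom_eval₂, hρ, map_zero] at h1
    have hb0 : ρ b = 0 := by simp [ρ, hιb]
    rw [hb0, Polynomial.eval₂_at_zero, RingHom.comp_apply] at h1
    exact (FaithfulSMul.algebraMap_injective F A) (h1.trans (map_zero _).symm)
  have hconst : ∀ t : F, t ≠ 0 → eval (opt t Y₀) g0 = eval (opt t 0) g0 := by
    intro t ht
    let p : Polynomial F := aeval (fun o => o.elim (Polynomial.C t) (fun i => Polynomial.X * Polynomial.C (Y₀ i))) g0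
    have hp : ∀ s, p.eval s = eval (opt t (fun i => s * Y₀ i)) g0 := by
      intro s
      have : (Polynomial.evalRingHom s).comp (aeval (R := F) 
          (fun o : Option (Fin r) => o.elim (Polynomial.C t) (fun i => Polynomial.X * Polynomial.C (Y₀ i)))).toRingHom = 
          eval (opt t (fun i => s * Y₀ i)) := by
        apply MvPolynomial.ringHom_ext
        · intro c; simp [Polynomial.algebraMap_eq]
        · intro o
          cases o
          · simp [opt]
          · simp [opt]
            ring
      exact RingHom.congr_fun this g0
    have hdeg : p.degree = 0 := by
      by_contra hd
      obtain ⟨s, hs⟩ := IsAlgClosed.exists_root p hd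
      rw [Polynomial.IsRoot, hp] at hs
      exact hne _ _ ht hs
    have hpC := Polynomial.eq_C_of_degree_eq_zero hdeg
    have h1 := hp 1
    have h2 := hp 0
    rw [hpC, Polynomial.eval_C] at h1 h2
    simp only [one_mul, zero_mul] at h1 h2
    exact h1.symm.trans h2
  have hpoly : ∀ Y : Fin r → F, ∃ p : Polynomial F, ∀ s, p.eval s = eval (opt s Y) g0 := by
    intro Y
    refine ⟨aeval (fun o => o.elim Polynomial.X (fun i => Polynomial.C (Y i))) g0, fun s => ?_⟩
    have : (Polynomial.evalRingHom s).comp (aeval (R := F) 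
        (fun o : Option (Fin r) => o.elim Polynomial.X (fun i => Polynomial.C (Y i)))).toRingHom = 
        eval (opt s Y) := by
      apply MvPolynomial.ringHom_ext
      · intro c; simp [Polynomial.algebraMap_eq]
      · intro o; cases o <;> simp [opt]
    exact RingHom.congr_fun this g0
  obtain ⟨p1, hp1⟩ := hpoly Y₀
  obtain ⟨p2, hp2⟩ := hpoly 0
  have heq : p1 = p2 := by
    apply Polynomial.eq_of_infinite_eval_eq
    apply Set.Infinite.mono (s := {0}ᶜ)
    · intro t ht
      change p1.eval t = p2.eval t
      rw [hp1, hp2]; exact hconst t ht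
    · exact (Set.finite_singleton 0).infinite_compl
  have hfin : eval (opt 0 Y₀) g0 = 0 := by
    rw [← hp1, heq, hp2, h00]
  exact root_ext (eval (opt 0 Y₀)) b 0 (hroot0 _ hfin)

end ConeSec


set_option linter.unusedSectionVars false

section ConeEx

variable {F : Type} [Field F] [Infinite F]

lemma lc_apply {A : Type} [CommRing A] [Algebra F A] {n : ℕ} (x : Fin n → A) (v : Fin n → F) : 
    Fintype.linearCombination F x v = ∑ j, v j • x j := rfl

lemma cone_inj {A : Type} [CommRing A] [Algebra F A] {r : ℕ} (z : Fin r → A) 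
    (hz : AlgebraicIndependent F z) : Function.Injective (aeval (R := F) (fun o : Option (Fin r) => 
      o.elim (Polynomial.X : Polynomial A) (fun i => Polynomial.X * Polynomial.C (z i)))) := by
  rw [injective_iff_map_eq_zero]
  intro p hp
  by_contra hne
  obtain ⟨P, hP⟩ : ∃ P, eval P (p * X none) ≠ 0 := by
    by_contra hcon
    push Not at hcon
    exact mul_ne_zero hne (X_ne_zero none) (MvPolynomial.funext fun a => by rw [hcon a, map_zero])
  rw [map_mul, eval_X] at hP
  have ht : P none ≠ 0 := right_ne_zero_of_mul hP
  apply left_ne_zero_of_mul hP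
  let θ : MvPolynomial (Option (Fin r)) F →ₐ[F] MvPolynomial (Fin r) F := 
    aeval (fun o => o.elim (C (P none)) (fun i => C (P none) * X i))
  have h1 : aeval z (θ p) = 0 := by
    have h2 : (aeval z).comp θ = ((Polynomial.aeval (algebraMap F A (P none)) : Polynomial A →ₐ[A] A).restrictScalars F).comp
      (aeval (R := F) (fun o : Option (Fin r) => 
      o.elim (Polynomial.X : Polynomial A) (fun i => Polynomial.X * Polynomial.C (z i)))) := by
      ext o
      cases o
      · simp [θ]
      · simp [θ]
        try rw [mul_comm]
    have := AlgHom.congr_fun h2 p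
    rw [AlgHom.comp_apply, AlgHom.comp_apply, hp, map_zero] at this
    exact this
  have h3 : θ p = 0 := (algebraicIndependent_iff.1 hz) _ h1
  have h4 : (aeval (fun i => P (some i) / P none)).comp θ = (aeval P : MvPolynomial (Option (Fin r)) F →ₐ[F] F) := by
    ext o
    cases o
    · simp [θ]
    · simp [θ]
      field_simp
  have := AlgHom.congr_fun h4 p
  rw [AlgHom.comp_apply, h3, map_zero] at this
  rw [← aeval_eq_eval]
  exact this.symm

lemma exists_cone {A : Type} [CommRing A] [IsDomain A] [Algebra F A] {n : ℕ} (x : Fin n → A) :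
    ∃ (r : ℕ) (y : Fin r → Fin n → F), AlgebraicIndependent F (fun i => ∑ j, y i j • x j) ∧ 
    ∃ (B : Type) (_ : CommRing B) (_ : IsDomain B) (_ : Algebra (MvPolynomial (Option (Fin r)) F) B)
      (_ : FaithfulSMul (MvPolynomial (Option (Fin r)) F) B) 
      (_ : Algebra.IsIntegral (MvPolynomial (Option (Fin r)) F) B) (ι : B →+* Polynomial A) (τ : Fin n → B), 
      Cone x y ι τ := by
  obtain ⟨r, y, hind, hint⟩ := NN (F := F) x
  refine ⟨r, y, hind, ?_⟩
  set z : Fin r → A := fun i => Fintype.linearCombination F x (y i) with hz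
  let θ := aeval (R := F) (fun o : Option (Fin r) => 
      o.elim (Polynomial.X : Polynomial A) (fun i => Polynomial.X * Polynomial.C (z i)))
  have hθ : Function.Injective θ := cone_inj z hind
  have hrange : Algebra.adjoin F (coneGen x y) = θ.range := by
    rw [← Algebra.adjoin_range_eq_range_aeval]
    congr 1
    ext p
    simp only [coneGen, Set.mem_insert_iff, Set.mem_range, Option.exists]
    simp [eq_comm, z]
  rw [hrange] at hint
  let _ : Algebra (MvPolynomial (Option (Fin r)) F) (Polynomial A) := θ.toRingHom.toAlgebra
  have hint' : ∀ j, IsIntegral (MvPolynomial (Option (Fin r)) F) (Polynomial.X * Polynomial.C (x j)) := by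
    intro j
    let e := AlgEquiv.ofInjective θ hθ
    refine IsIntegral.map_of_comp_eq (e.symm : θ.range →+* MvPolynomial (Option (Fin r)) F) (RingHom.id _) ?_ (hint j)
    ext1 ⟨a, p, hp⟩
    have : e.symm ⟨a, p, hp⟩ = p := by
      rw [AlgEquiv.symm_apply_eq]
      exact Subtype.ext hp.symm
    simp only [RingHom.comp_apply, RingHom.coe_coe, this]
    exact hp
  let B := integralClosure (MvPolynomial (Option (Fin r)) F) (Polynomial A)
  let τ : Fin n → B := fun j => ⟨_, hint' j⟩
  refine ⟨B, inferInstance, inferInstance, inferInstance, ?_, inferInstance, B.val.toRingHom, τ, ?_⟩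
  · rw [faithfulSMul_iff_algebraMap_injective]
    intro p q hpq
    exact hθ (congrArg Subtype.val hpq)
  · refine ⟨Subtype.val_injective, ?_, ?_, fun j => rfl, ?_⟩
    · intro c
      change θ (C c) = _
      rw [algHom_C]; rfl
    · change θ (X none) = _
      simp [θ]
    · intro i
      apply Subtype.val_injective
      change θ (X (some i)) = B.val (∑ j, _)
      rw [map_sum]
      change θ (X (some i)) = ∑ j, θ (C (y i j)) * (Polynomial.X * Polynomial.C (x j))
      simp only [θ, aeval_X, Option.elim, z, lc_apply, algHom_C, map_sum, Finset.mul_sum]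
      apply Finset.sum_congr rfl
      intro j _
      rw [Algebra.smul_def, Polynomial.C_mul]
      change _ = Polynomial.C (algebraMap F A (y i j)) * _
      ring

lemma cone_integral {n r : ℕ} {A B : Type} [CommRing A] [Algebra F A] [CommRing B] 
    [Algebra (MvPolynomial (Option (Fin r)) F) B] [Algebra.IsIntegral (MvPolynomial (Option (Fin r)) F) B] 
    {x : Fin n → A} {y : Fin r → Fin n → F} {ι : B →+* Polynomial A} {τ : Fin n → B} (hc : Cone x y ι τ)
    (hx : Algebra.adjoin F (Set.range x) = ⊤) [Algebra (MvPolynomial (Fin r) F) A] 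
    (halg : algebraMap (MvPolynomial (Fin r) F) A = 
      (aeval (R := F) (fun i => ∑ j, y i j • x j) : MvPolynomial (Fin r) F →ₐ[F] A).toRingHom) : 
    Algebra.IsIntegral (MvPolynomial (Fin r) F) A := by
  have halg' : ∀ p, algebraMap (MvPolynomial (Fin r) F) A p = aeval (R := F) (fun i => ∑ j, y i j • x j) p := by
    intro p; rw [halg]; rfl
  have hxj : ∀ j, IsIntegral (MvPolynomial (Fin r) F) (x j) := by
    intro j
    let θ : MvPolynomial (Option (Fin r)) F →ₐ[F] MvPolynomial (Fin r) F := 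
      aeval (fun o => o.elim 1 (fun i => X i))
    let ρ : B →+* A := (Polynomial.evalRingHom 1).comp ι
    have h1 : ρ (τ j) = x j := by simp [ρ, hc.hτ]
    rw [← h1]
    refine IsIntegral.map_of_comp_eq θ.toRingHom ρ ?_ (Algebra.IsIntegral.isIntegral (τ j))
    apply MvPolynomial.ringHom_ext
    · intro c
      simp [ρ, hc.hC, θ, halg']
    · intro o
      cases o with
      | none => simp [ρ, hc.ht, θ]
      | some i =>
        rw [RingHom.comp_apply, RingHom.comp_apply, hc.hy]
        simp [ρ, hc.hC, hc.hτ, θ, halg', Algebra.smul_def]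
  refine ⟨fun a => ?_⟩
  have ha : a ∈ Algebra.adjoin F (Set.range x) := by rw [hx]; trivial
  induction ha using Algebra.adjoin_induction with
  | mem a ha => obtain ⟨j, rfl⟩ := ha; exact hxj j
  | algebraMap c => 
    have : algebraMap F A c = algebraMap (MvPolynomial (Fin r) F) A (C c) := by rw [halg', aeval_C]
    rw [this]; exact isIntegral_algebraMap
  | add a b _ _ ha hb => exact ha.add hb
  | mul a b _ _ ha hb => exact ha.mul hb
end ConeEx


set_option linter.unusedSectionVars false

section Comp

variable {F : Type} [Field F] [IsAlgClosed F] {n : ℕ}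

lemma lin_sections (r : ℕ) (y : Fin r → Fin n → F) (hy : LinearIndependent F y) (c : Fin r → F) : 
    IsAffSubspaceOfDim F n (n - r) {w | ∀ i, ∑ j, y i j * w j = c i} := by
  let M : Matrix (Fin r) (Fin n) F := Matrix.of y
  have hrank : M.rank = r := by
    have : LinearIndependent F M.row := hy
    simpa using this.rank_matrix
  have hr : Module.finrank F (LinearMap.range M.mulVecLin) = r := hrank
  have htop : LinearMap.range M.mulVecLin = ⊤ := by
    apply Submodule.eq_top_of_finrank_eq
    rw [hr]; simp
  obtain ⟨p, hp⟩ := LinearMap.range_eq_top.1 htop c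
  have hker := LinearMap.finrank_range_add_finrank_ker M.mulVecLin
  rw [hr, Module.finrank_fin_fun] at hker
  refine ⟨AffineSubspace.mk' p (LinearMap.ker M.mulVecLin), ⟨p, AffineSubspace.self_mem_mk' _ _⟩, ?_, ?_⟩
  · rw [AffineSubspace.direction_mk']; omega
  · ext w
    rw [SetLike.mem_coe, AffineSubspace.mem_mk', LinearMap.mem_ker, vsub_eq_sub, map_sub, hp, sub_eq_zero, funext_iff]
    rfl

/-- The values `γ` with `e + ∑ γ^(j+1) q_j = 0` for some `q` in a finite set. -/
lemma bad_values (S : Set (Fin n → F)) (hS : S.Finite) (e : F) (hne : ∀ q ∈ S, e ≠ 0 ∨ q ≠ 0) : 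
    ∃ T : Finset F, T.card ≤ n * S.ncard ∧ ∀ γ ∉ T, ∀ q ∈ S, e + ∑ j : Fin n, γ ^ ((j : ℕ) + 1) * q j ≠ 0 := by
  let p : (Fin n → F) → Polynomial F := fun q => 
    Polynomial.C e + ∑ j : Fin n, Polynomial.C (q j) * Polynomial.X ^ ((j : ℕ) + 1)
  have hp : ∀ q ∈ S, p q ≠ 0 := by
    intro q hq h0
    rcases hne q hq with he | hq0
    · apply he
      have := congrArg (fun f => Polynomial.coeff f 0) h0
      simpa [p, Polynomial.finsetSum_coeff, Polynomial.coeff_X_pow] using this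
    · apply hq0
      ext j
      have := congrArg (fun f => Polynomial.coeff f ((j : ℕ) + 1)) h0
      simp only [p, Polynomial.coeff_add, Polynomial.finsetSum_coeff, Polynomial.coeff_C_mul, Polynomial.coeff_X_pow, 
        Polynomial.coeff_C_succ, zero_add, Polynomial.coeff_zero, add_left_inj, Fin.val_inj] at this
      simpa using this
  have hdeg : ∀ q, (p q).natDegree ≤ n := by
    intro q
    apply Polynomial.natDegree_add_le_of_degree_le
    · simp
    · apply Polynomial.natDegree_sum_le_of_forall_le
      intro j _
      refine (Polynomial.natDegree_C_mul_X_pow_le _ _).trans j.2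
  refine ⟨hS.toFinset.biUnion fun q => (p q).roots.toFinset, ?_, ?_⟩
  · rw [Set.ncard_eq_toFinset_card S hS, mul_comm]
    apply Finset.card_biUnion_le_card_mul
    intro q _
    exact (Multiset.toFinset_card_le _).trans ((Polynomial.card_roots' _).trans (hdeg q))
  · intro γ hγ q hq h0
    apply hγ
    rw [Finset.mem_biUnion]
    refine ⟨q, hS.mem_toFinset.2 hq, ?_⟩
    rw [Multiset.mem_toFinset, Polynomial.mem_roots (hp q hq), Polynomial.IsRoot]
    rw [← h0]
    simp only [p, Polynomial.eval_add, Polynomial.eval_C, Polynomial.eval_finsetSum, Polynomial.eval_mul, 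
      Polynomial.eval_pow, Polynomial.eval_X]
    congr 1
    exact Finset.sum_congr rfl fun j _ => mul_comm _ _

lemma affDim_neg (V : Set (Fin n → F)) (h : affDim F n V = -1) : V = ∅ := by
  by_contra hne
  rw [affDim, if_pos (Set.nonempty_iff_ne_empty.2 hne)] at h
  omega

lemma affDim_empty : affDim F n (∅ : Set (Fin n → F)) = -1 := by
  rw [affDim, if_neg Set.not_nonempty_empty]

lemma eval_affLinForm (γ : F) (w : Fin n → F) : 
    eval w (affLinForm F n γ) = 1 + ∑ j : Fin n, γ ^ ((j : ℕ) + 1) * w j := by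
  simp [affLinForm]

lemma dim_double_quot {R : Type} [CommRing R] (I : Ideal R) (f : R) : 
    ringKrullDim (R ⧸ (I ⊔ Ideal.span {f})) = ringKrullDim ((R ⧸ I) ⧸ Ideal.span {Ideal.Quotient.mk I f}) := by
  have e := DoubleQuot.quotQuotEquivQuotSup I (Ideal.span {f})
  rw [Ideal.map_span, Set.image_singleton] at e
  exact (ringKrullDim_eq_of_ringEquiv e).symm

lemma component_bound (W : Set (Fin n → F)) (hirr : IsIrredAffVariety F n W) : 
    ∃ T : Finset F, T.card ≤ n * affIrredDegree F n W ∧ ∀ γ ∉ T, 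
      affDim F n (W ∩ affZeroSet F n (affLinForm F n γ)) = affDim F n W - 1 := by
  have : Infinite F := IsAlgClosed.instInfinite
  have hprime := irred_prime hirr
  have hZ := affVariety_iff.1 hirr.1
  set I := vanishingIdeal F W with hI
  let A := MvPolynomial (Fin n) F ⧸ I
  have : IsDomain A := Ideal.Quotient.isDomain I
  let x : Fin n → A := fun j => Ideal.Quotient.mk I (X j)
  have hx : ∀ f, aeval x f = Ideal.Quotient.mk I f := by
    intro f
    have : (aeval x : MvPolynomial (Fin n) F →ₐ[F] A) = Ideal.Quotient.mkₐ F I := by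
      ext j; simp [x]; rfl
    rw [this]; rfl
  have hgen : Algebra.adjoin F (Set.range x) = ⊤ := by
    rw [Algebra.adjoin_range_eq_range_aeval, AlgHom.range_eq_top]
    intro a
    obtain ⟨f, rfl⟩ := Ideal.Quotient.mk_surjective a
    exact ⟨f, hx f⟩
  have hW : ∀ w, (∀ f : MvPolynomial (Fin n) F, aeval x f = 0 → eval w f = 0) → w ∈ W := by
    intro w hw
    rw [← hZ, mem_zeroLocus_iff]
    intro f hf
    rw [aeval_eq_eval]
    apply hw
    rw [hx]; exact Ideal.Quotient.eq_zero_iff_mem.2 hf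
  have hpt : ∀ w ∈ W, ∃ σ : A →ₐ[F] F, ∀ f, σ (Ideal.Quotient.mk I f) = eval w f := by
    intro w hw
    refine ⟨Ideal.Quotient.liftₐ I (aeval w) ?_, ?_⟩
    · intro f hf
      exact (mem_vanishingIdeal_iff.1 hf) w hw
    · intro f; rfl
  obtain ⟨r, y, hind, B, _, _, _, _, _, ι, τ, hc⟩ := exists_cone (F := F) x
  let _ : Algebra (MvPolynomial (Fin r) F) A := 
    (aeval (R := F) (fun i => ∑ j, y i j • x j) : MvPolynomial (Fin r) F →ₐ[F] A).toRingHom.toAlgebra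
  have hint : Algebra.IsIntegral (MvPolynomial (Fin r) F) A := cone_integral hc hgen rfl
  have hfaith : FaithfulSMul (MvPolynomial (Fin r) F) A := 
    (faithfulSMul_iff_algebraMap_injective _ _).2 hind
  have hdim : ringKrullDim A = r := dim_of_integral F r
  have hdimW : affDim F n W = r := by
    have := affDim_zeroLocus I (by rw [hZ]; exact hirr.2.1) r hdim
    rwa [hZ] at this
  have hyli : LinearIndependent F y := by
    apply LinearIndependent.of_comp (Fintype.linearCombination F x)
    exact hind.linearIndependent
  have hfin : ∀ c : Fin r → F, (W ∩ {w | ∀ i, ∑ j, y i j * w j = c i}).Finite := by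
    intro c
    apply (coneFib_finite τ (opt 1 c)).subset
    rintro w ⟨hw, hwc⟩
    obtain ⟨σ, hσ⟩ := hpt w hw
    have hσx : ∀ j, σ (x j) = w j := fun j => by rw [hσ, eval_X]
    obtain ⟨φ, hφ, hφτ⟩ := hc.of_point σ 1
    refine ⟨φ, ?_, ?_⟩
    · rw [hφ]
      congr 2
      ext i
      simp only [hσx, one_mul]
      exact hwc i
    · intro j
      rw [hφτ, one_mul, hσx]
  have hdeg : ∀ c : Fin r → F, (W ∩ {w | ∀ i, ∑ j, y i j * w j = c i}).ncard ≤ affIrredDegree F n W := by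
    intro c
    apply le_csSup
    · obtain ⟨N, hN⟩ := section_bound W hirr.1 (n - (affDim F n W).toNat)
      refine ⟨N, ?_⟩
      rintro m ⟨L, hL, hLf, rfl⟩
      exact hN L hL hLf
    · refine ⟨_, ?_, hfin c, rfl⟩
      rw [hdimW, Int.toNat_natCast]
      exact lin_sections r y hyli c
  rcases Nat.eq_zero_or_pos r with hr0 | hrpos
  · subst hr0
    have hL : (W ∩ {w | ∀ i, ∑ j, y i j * w j = (0 : Fin 0 → F) i}) = W := by
      ext w; simp
    have hWfin := hfin 0
    have hWdeg := hdeg 0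
    rw [hL] at hWfin hWdeg
    obtain ⟨T, hT, hT'⟩ := bad_values W hWfin 1 (fun _ _ => Or.inl one_ne_zero)
    refine ⟨T, hT.trans (Nat.mul_le_mul_left _ hWdeg), fun γ hγ => ?_⟩
    have : W ∩ affZeroSet F n (affLinForm F n γ) = ∅ := by
      rw [Set.eq_empty_iff_forall_notMem]
      rintro w ⟨hw, h0⟩
      apply hT' γ hγ w hw
      rw [← eval_affLinForm]; exact h0
    rw [this, affDim_empty, hdimW]; rfl
  · let Y₀ : Fin r → F := fun _ => 1
    have hS := coneFib_finite τ (opt 0 Y₀)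
    obtain ⟨T, hT, hT'⟩ := bad_values (coneFib τ (opt 0 Y₀)) hS 0 (by
      rintro q ⟨φ, hφ, hq⟩
      right
      rintro rfl
      have := hc.point_lin 0 Y₀ φ hφ ⟨0, hrpos⟩
      simp only [← hq] at this
      simp [Y₀] at this)
    obtain ⟨c, hcount⟩ := hc.count W hW hfin (opt 0 Y₀)
    refine ⟨T, hT.trans (Nat.mul_le_mul_left _ (hcount.trans (hdeg c))), fun γ hγ => ?_⟩
    set ℓ := affLinForm F n γ with hℓ
    have hnotbad : ¬ (1 + ∑ j : Fin n, γ ^ ((j : ℕ) + 1) • x j = 0 ∨ 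
        ∀ w ∈ W, 1 + ∑ j : Fin n, γ ^ ((j : ℕ) + 1) * w j ≠ 0) := by
      intro hbad
      obtain ⟨q, hq, h0⟩ := hc.bad W hW Y₀ (fun j : Fin n => γ ^ ((j : ℕ) + 1)) hbad
      apply hT' γ hγ q hq
      rw [zero_add]; exact h0
    push Not at hnotbad
    obtain ⟨hne, w, hw, hw0⟩ := hnotbad
    have hmk : Ideal.Quotient.mk I ℓ = 1 + ∑ j : Fin n, γ ^ ((j : ℕ) + 1) • x j := by
      rw [← hx]
      rw [hℓ, affLinForm, map_add, map_sum, C_1, map_one]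
      congr 1
      apply Finset.sum_congr rfl
      intro j _
      rw [map_mul, aeval_C, aeval_X]
      exact (Algebra.smul_def _ _).symm
    rw [← hmk] at hne
    rw [← eval_affLinForm] at hw0
    have hnu : ¬ IsUnit (Ideal.Quotient.mk I ℓ) := by
      intro hu
      obtain ⟨σ, hσ⟩ := hpt w hw
      have := hu.map σ
      rw [hσ, hw0] at this
      exact not_isUnit_zero this
    have hdq := dim_quotient_of_integral F r _ hne hnu
    obtain ⟨r', rfl⟩ : ∃ r', r = r' + 1 := ⟨r - 1, by omega⟩
    have hdq' : ringKrullDim (A ⧸ Ideal.span {Ideal.Quotient.mk I ℓ}) = r' := by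
      rw [Nat.cast_add, Nat.cast_one] at hdq
      exact ENat.WithBot.add_one_cancel.mp hdq
    have hsec : W ∩ affZeroSet F n ℓ = zeroLocus F (I ⊔ Ideal.span {ℓ}) := by
      ext v
      rw [mem_zeroLocus_iff]
      constructor
      · rintro ⟨hv, hv0⟩ f hf
        obtain ⟨a, ha, b, hb, rfl⟩ := Submodule.mem_sup.1 hf
        obtain ⟨k, rfl⟩ := Ideal.mem_span_singleton'.1 hb
        have h1 : aeval v a = 0 := (mem_vanishingIdeal_iff.1 ha) v hv
        have h2 : aeval v ℓ = 0 := by rw [aeval_eq_eval]; exact hv0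
        rw [map_add, h1, map_mul, h2, mul_zero, add_zero]
      · intro h
        constructor
        · rw [← hZ, mem_zeroLocus_iff]
          intro f hf
          exact h f (Ideal.mem_sup_left hf)
        · have := h ℓ (Ideal.mem_sup_right (Ideal.mem_span_singleton_self ℓ))
          rw [aeval_eq_eval] at this
          exact this
    have hdq2 : ringKrullDim (MvPolynomial (Fin n) F ⧸ (I ⊔ Ideal.span {ℓ})) = r' := by
      rw [← hdq']; exact dim_double_quot I ℓ
    rw [hsec, affDim_zeroLocus _ (by rw [← hsec]; exact ⟨w, hw, hw0⟩) r' hdq2, hdimW]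
    push_cast; ring

end Comp


/-- For a nonempty affine variety `V ⊆ 𝔸^n` of degree `d` there
is a nonzero univariate polynomial `P` of degree at most `nd` such that for every
`γ` with `P(γ) ≠ 0`, the affine hyperplane `V(1 + γx₁ + ⋯ + γⁿxₙ)` cuts every
irreducible component of `V` in dimension exactly one less; in particular it
misses the zero-dimensional components. -/
theorem generic_hyperplane_section_affine (n d : ℕ) (V : Set (Fin n → F))
    (hV : IsAffVariety F n V) (hne : V.Nonempty) (hdeg : affDegree F n V = d) :
    ∃ P : Polynomial F, P ≠ 0 ∧ P.natDegree ≤ n * d ∧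
      ∀ γ : F, Polynomial.eval γ P ≠ 0 →
        ∀ Vi, IsAffIrredComponent F n Vi V →
          affDim F n (Vi ∩ affZeroSet F n (affLinForm F n γ)) = affDim F n Vi - 1 ∧
          (affDim F n Vi = 0 → Vi ∩ affZeroSet F n (affLinForm F n γ) = ∅) := by

  have hfin := finite_components V hV
  choose T hT hT' using fun W : {W | IsAffIrredComponent F n W V} => component_bound W.1 W.2.1
  have : Fintype {W | IsAffIrredComponent F n W V} := hfin.fintype
  let P : Polynomial F := ∏ W : {W | IsAffIrredComponent F n W V}, ∏ γ ∈ T W, (Polynomial.X - Polynomial.C γ)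
  have hP : P.Monic := Polynomial.monic_prod_of_monic _ _ fun W _ => Polynomial.monic_prod_X_sub_C _ _
  refine ⟨P, hP.ne_zero, ?_, ?_⟩
  · rw [Polynomial.natDegree_prod_of_monic _ _ fun W _ => Polynomial.monic_prod_X_sub_C _ _]
    rw [← hdeg, affDegree, ← finsum_set_coe_eq_finsum_mem, finsum_eq_sum_of_fintype, Finset.mul_sum]
    apply Finset.sum_le_sum
    intro W _
    rw [Polynomial.natDegree_finsetProd_X_sub_C_eq_card]
    exact hT W
  · intro γ hγ Vi hVi
    have hnot : γ ∉ T ⟨Vi, hVi⟩ := by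
      intro hmem
      apply hγ
      rw [Polynomial.eval_prod]
      apply Finset.prod_eq_zero (Finset.mem_univ (⟨Vi, hVi⟩ : {W | IsAffIrredComponent F n W V}))
      rw [Polynomial.eval_prod]
      apply Finset.prod_eq_zero hmem
      simp
    have h := hT' ⟨Vi, hVi⟩ γ hnot
    refine ⟨h, fun h0 => affDim_neg _ ?_⟩
    rw [h]
    change affDim F n Vi - 1 = -1
    rw [h0]; rfl
end
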